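/- arXiv:2203.02970 — 2 statements merged into one kernel-verified Lean document; each statement's English description precedes it below -/
import Mathlib

section
/- Assume Λ ⊆ ℂ is a compact q-invariant set on which q is uniformly expanding, let A = g(Λ), and suppose ε₀ > 0 and, for each b with 0 < |b| < ε₀, A_b ⊆ ℂ² is a compact H_b-invariant uniformly hyperbolic set such that H_b restricted to A_b is topologically conjugate to the shift on Σ(A, H₀), and A_b converges to A in the Hausdorff distance as b → 0. Then: A_b = J(H_b) for all sufficiently small b ≠ 0 if and only if Λ = J(q). -/
noncomputable section
open Set Metric Topology Filter ENNReal

/-- The quadratic map `q(x) = x² + c`. -/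
def qmap (c : ℂ) : ℂ → ℂ := fun x => x ^ 2 + c

/-- The Hénon map `H_b(x,y) = (x² + c − b·y, x)`; `H₀(x,y) = (q(x), x)`. -/
def henon (c b : ℂ) : ℂ × ℂ → ℂ × ℂ := fun p => (p.1 ^ 2 + c - b * p.2, p.1)

/-- `g(x) = (q(x), x)`. -/
def gmap (c : ℂ) : ℂ → ℂ × ℂ := fun x => (qmap c x, x)

/-- A set `S` is invariant under `f` if `f⁻¹(S) = S`. -/
def Invariant {α : Type*} (f : α → α) (S : Set α) : Prop := f ⁻¹' S = S

/-- `Σ(S, f)`: bi-infinite orbit sequences of `f` lying in `S`, topologized as a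
subspace of the product space `ℤ → X`. -/
def SigmaSet {X : Type*} (f : X → X) (S : Set X) : Set (ℤ → X) :=
  {z | (∀ i, z i ∈ S) ∧ ∀ i, f (z i) = z (i + 1)}

/-- The shift on bi-infinite sequences. -/
def shiftSeq {X : Type*} (z : ℤ → X) : ℤ → X := fun i => z (i + 1)

lemma shiftSeq_mem {X : Type*} {f : X → X} {S : Set X} {z : ℤ → X}
    (hz : z ∈ SigmaSet f S) : shiftSeq z ∈ SigmaSet f S :=
  ⟨fun i => hz.1 (i + 1), fun i => hz.2 (i + 1)⟩

/-- The shift map `σ` as a self-map of `Σ(S, f)`. -/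
def sigmaShift {X : Type*} (f : X → X) (S : Set X) :
    (SigmaSet f S) → (SigmaSet f S) :=
  fun z => ⟨shiftSeq z.1, shiftSeq_mem z.2⟩

/-- The inverse of the Hénon map (for `b ≠ 0`). -/
def henonInv (c b : ℂ) : ℂ × ℂ → ℂ × ℂ := fun p => (p.2, (p.2 ^ 2 + c - p.1) / b)

/-- `K(f)`: points with bounded forward orbit. -/
def Kset {E : Type*} [NormedAddCommGroup E] (f : E → E) : Set E :=
  {z | ∃ R : ℝ, ∀ n : ℕ, ‖f^[n] z‖ ≤ R}

/-- `J(f) = ∂K(f)`. -/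
def Jset {E : Type*} [NormedAddCommGroup E] (f : E → E) : Set E := frontier (Kset f)

/-- The Julia set `J(H_b) = J⁺(H_b) ∩ J⁻(H_b)` of the Hénon map. -/
def henonJulia (c b : ℂ) : Set (ℂ × ℂ) := Jset (henon c b) ∩ Jset (henonInv c b)

/-- A set `S` is uniformly expanding for `f : ℂ → ℂ`:
`∃ C > 0, λ > 1` with `|D(fⁿ)(z)| ≥ C·λⁿ` for all `z ∈ S`, `n ≥ 1`. -/
def IsExpandingOn (f : ℂ → ℂ) (S : Set ℂ) : Prop :=
  ∃ C > 0, ∃ lam > 1, ∀ z ∈ S, ∀ n : ℕ, 1 ≤ n → C * lam ^ n ≤ ‖deriv (f^[n]) z‖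

/-- Uniform hyperbolicity of a compact invariant set of a diffeomorphism `f`
(with inverse `finv`): a splitting `ℂ^k = Eˢ_z ⊕ Eᵘ_z` varying continuously with
`z` (encoded by the projection `P z` onto `Eˢ_z` along `Eᵘ_z`), invariant under
`Df`, with uniform contraction rates `(λ_s, λ_u)` on `Eˢ` under forward iterates
and on `Eᵘ` under backward iterates. -/
def IsHyperbolicSet {E : Type*} [NormedAddCommGroup E] [NormedSpace ℂ E]
    (f finv : E → E) (S : Set E) : Prop :=
  ∃ (Es Eu : E → Submodule ℂ E) (P : E → E →L[ℂ] E) (Cs Cu lams lamu : ℝ),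
    0 < Cs ∧ 0 < Cu ∧ 0 < lams ∧ lams < 1 ∧ 1 < lamu ∧
    ContinuousOn P S ∧
    (∀ z ∈ S, ∀ v : E, P z v ∈ Es z ∧ v - P z v ∈ Eu z) ∧
    (∀ z ∈ S, ∀ v ∈ Es z, P z v = v) ∧
    (∀ z ∈ S, ∀ v ∈ Eu z, P z v = 0) ∧
    (∀ z ∈ S, (Es z).map (fderiv ℂ f z).toLinearMap = Es (f z)) ∧
    (∀ z ∈ S, (Eu z).map (fderiv ℂ f z).toLinearMap = Eu (f z)) ∧
    (∀ z ∈ S, ∀ n : ℕ, 1 ≤ n → ∀ v ∈ Es z, ‖fderiv ℂ (f^[n]) z v‖ ≤ Cs * lams ^ n * ‖v‖) ∧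
    (∀ z ∈ S, ∀ n : ℕ, 1 ≤ n → ∀ v ∈ Eu z, ‖fderiv ℂ (finv^[n]) z v‖ ≤ Cu * (lamu ^ n)⁻¹ * ‖v‖)

/-! ### Boundedness of orbits -/

/-- Every closed ball of radius at least `R` keeps the forward orbits of those of its points
whose orbit is bounded. -/
def TrapsBounded {E : Type*} [NormedAddCommGroup E] (f : E → E) (R : ℝ) : Prop :=
  ∀ R', R ≤ R' → ∀ p ∈ Kset f, ‖p‖ ≤ R' → ∀ n : ℕ, ‖f^[n] p‖ ≤ R'

lemma le_max_of_sq_le {ι : Type*} (s : ι → ℝ) {C R B : ℝ} (hC : 0 ≤ C) (hB : ∀ i, s i ≤ B)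
    (h : ∀ i, s i ≤ R ∨ ∃ j k, s i ^ 2 ≤ C + s j + s k) (i : ι) : s i ≤ max R (C + 3) := by
  by_contra! hi
  have hbdd : BddAbove (range s) := ⟨B, by rintro _ ⟨j, rfl⟩; exact hB j⟩
  set M := ⨆ j, s j
  have hle : ∀ j, s j ≤ M := fun j => le_ciSup hbdd j
  have hM : max R (C + 3) < M := hi.trans_le (hle i)
  have hM3 : C + 3 < M := (le_max_right _ _).trans_lt hM
  have hsqrt : √(C + 2 * M) < M := by
    rw [Real.sqrt_lt' (by linarith)]
    nlinarith
  have : Nonempty ι := ⟨i⟩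
  obtain ⟨j, hj⟩ := exists_lt_of_lt_ciSup (max_lt hM hsqrt)
  have hjR := (le_max_left _ _).trans_lt ((le_max_left _ _).trans_lt hj)
  have hjS := (le_max_right _ _).trans_lt hj
  rcases h j with h1 | ⟨k, l, hkl⟩
  · linarith
  · exact absurd (Real.le_sqrt_of_sq_le (hkl.trans (by linarith [hle k, hle l]))) (not_le.2 hjS)

lemma norm_iterate_qmap_le {c x : ℂ} (hx : x ∈ Kset (qmap c)) (n : ℕ) :
    ‖(qmap c)^[n] x‖ ≤ ‖c‖ + 3 := by
  obtain ⟨B, hB⟩ := hx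
  have := le_max_of_sq_le (fun n => ‖(qmap c)^[n] x‖) (R := 0) (norm_nonneg c) hB (fun n => ?_) n
  · simpa [max_eq_right (by positivity : (0 : ℝ) ≤ ‖c‖ + 3)] using this
  · refine Or.inr ⟨n + 1, n + 1, ?_⟩
    simp only [Function.iterate_succ_apply', ← norm_pow]
    have h := norm_sub_le (qmap c ((qmap c)^[n] x)) c
    have e : qmap c ((qmap c)^[n] x) - c = ((qmap c)^[n] x) ^ 2 := by simp [qmap]
    rw [e] at h
    linarith [norm_nonneg (qmap c ((qmap c)^[n] x))]

lemma trapsBounded_qmap (c : ℂ) : TrapsBounded (qmap c) (‖c‖ + 3) :=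
  fun _ hR _ hp _ n => (norm_iterate_qmap_le hp n).trans hR

lemma trapsBounded_henon {c b : ℂ} (hb : ‖b‖ ≤ 1) : TrapsBounded (henon c b) (‖c‖ + 3) := by
  intro R hR p ⟨B, hB⟩ hp n
  have h1 : ∀ n, ((henon c b)^[n] p).1 = ((henon c b)^[n + 1] p).2 := fun n => by
    rw [Function.iterate_succ_apply']; rfl
  have key := le_max_of_sq_le (fun n => ‖((henon c b)^[n] p).2‖) (R := R) (norm_nonneg c)
    (fun n => (norm_snd_le _).trans (hB n)) (fun n => ?_)
  · rw [max_eq_left hR] at key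
    rw [Prod.norm_def, h1]
    exact max_le (key _) (key _)
  · rcases n with _ | _ | n
    · exact Or.inl ((norm_snd_le _).trans hp)
    · exact Or.inl ((norm_fst_le _).trans hp)
    · refine Or.inr ⟨n + 3, n + 1, ?_⟩
      have e : ((henon c b)^[n + 2] p).2 ^ 2 =
          ((henon c b)^[n + 3] p).2 + b * ((henon c b)^[n + 1] p).2 - c := by
        rw [← h1, ← h1, Function.iterate_succ_apply' _ (n + 1)]
        simp [henon, Function.iterate_succ_apply']
      simp only [← norm_pow]
      rw [e]
      refine (norm_sub_le _ _).trans ?_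
      have := norm_add_le ((henon c b)^[n + 3] p).2 (b * ((henon c b)^[n + 1] p).2)
      rw [norm_mul] at this
      nlinarith [norm_nonneg ((henon c b)^[n + 1] p).2]

lemma trapsBounded_henonInv {c b : ℂ} (hb0 : b ≠ 0) (hb : ‖b‖ ≤ 1) :
    TrapsBounded (henonInv c b) (‖c‖ + 3) := by
  intro R hR p ⟨B, hB⟩ hp n
  have h1 : ∀ n, ((henonInv c b)^[n] p).2 = ((henonInv c b)^[n + 1] p).1 := fun n => by
    rw [Function.iterate_succ_apply']; rfl
  have key := le_max_of_sq_le (fun n => ‖((henonInv c b)^[n] p).1‖) (R := R) (norm_nonneg c)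
    (fun n => (norm_fst_le _).trans (hB n)) (fun n => ?_)
  · rw [max_eq_left hR] at key
    rw [Prod.norm_def, h1]
    exact max_le (key _) (key _)
  · rcases n with _ | _ | n
    · exact Or.inl ((norm_fst_le _).trans hp)
    · exact Or.inl ((norm_snd_le _).trans hp)
    · refine Or.inr ⟨n + 3, n + 1, ?_⟩
      have e : ((henonInv c b)^[n + 2] p).1 ^ 2 =
          b * ((henonInv c b)^[n + 3] p).1 + ((henonInv c b)^[n + 1] p).1 - c := by
        rw [← h1, ← h1, Function.iterate_succ_apply' _ (n + 1)]
        simp only [henonInv]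
        rw [Function.iterate_succ_apply' _ n]
        simp only [henonInv]
        field_simp
        ring
      simp only [← norm_pow]
      rw [e]
      refine (norm_sub_le _ _).trans ?_
      have := norm_add_le (b * ((henonInv c b)^[n + 3] p).1) ((henonInv c b)^[n + 1] p).1
      rw [norm_mul] at this
      nlinarith [norm_nonneg ((henonInv c b)^[n + 3] p).1]

lemma isClosed_Kset {E : Type*} [NormedAddCommGroup E] {f : E → E} {R : ℝ}
    (hf : Continuous f) (ht : TrapsBounded f R) : IsClosed (Kset f) := by
  rw [← closure_subset_iff_isClosed]
  intro p hp
  set R' := max R (‖p‖ + 1)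
  refine ⟨R', fun n => ?_⟩
  have hcl : IsClosed {x | ‖f^[n] x‖ ≤ R'} :=
    isClosed_le (hf.iterate n).norm continuous_const
  refine (hcl.closure_subset_iff.2 (fun x hx => ?_) : closure (ball p 1 ∩ Kset f) ⊆ _) ?_
  · refine ht R' (le_max_left _ _) x hx.2 (le_trans ?_ (le_max_right _ _)) n
    have h1 : ‖x - p‖ < 1 := mem_ball_iff_norm.1 hx.1
    have h2 := norm_add_le (x - p) p
    rw [sub_add_cancel] at h2
    linarith
  · rw [Metric.mem_closure_iff] at hp ⊢
    intro ε hε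
    obtain ⟨y, hy, hd⟩ := hp (min ε 1) (lt_min hε one_pos)
    exact ⟨y, ⟨by rw [mem_ball, dist_comm]; exact hd.trans_le (min_le_right _ _), hy⟩,
      hd.trans_le (min_le_left _ _)⟩

lemma exists_uniform_bound_of_mem_interior {E : Type*} [NormedAddCommGroup E] {f : E → E}
    {R : ℝ} (ht : TrapsBounded f R) {p : E} (hp : p ∈ interior (Kset f)) :
    ∃ ρ > 0, ∃ M, ∀ x, ‖x - p‖ ≤ ρ → ∀ n : ℕ, ‖f^[n] x‖ ≤ M := by
  obtain ⟨ρ, hρ, hsub⟩ := Metric.mem_nhds_iff.1 (mem_interior_iff_mem_nhds.1 hp)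
  refine ⟨ρ / 2, by positivity, max R (‖p‖ + ρ), fun x hx => ?_⟩
  refine ht _ (le_max_left _ _) x (hsub (mem_ball_iff_norm.2 (by linarith)))
    (le_trans ?_ (le_max_right _ _))
  have h2 := norm_add_le (x - p) p
  rw [sub_add_cancel] at h2
  linarith

lemma norm_hasDerivAt_le {E : Type*} [NormedAddCommGroup E] [NormedSpace ℂ E] {f : ℂ → E}
    (hf : Differentiable ℂ f) {V : E} {M ρ : ℝ} {x : ℂ} (hρ : 0 < ρ)
    (hM : ∀ t, ‖t - x‖ ≤ ρ → ‖f t‖ ≤ M) (hV : HasDerivAt f V x) : ‖V‖ ≤ M / ρ := by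
  rw [← hV.deriv]
  exact Complex.norm_deriv_le_of_forall_mem_sphere_norm_le hρ hf.diffContOnCl
    fun z hz => hM z (mem_sphere_iff_norm.1 hz).le

lemma image_mem_Kset_iff {E : Type*} [NormedAddCommGroup E] {f : E → E} {p : E} :
    f p ∈ Kset f ↔ p ∈ Kset f := by
  constructor
  · rintro ⟨R, hR⟩
    refine ⟨max ‖p‖ R, fun n => ?_⟩
    rcases n with _ | n
    · exact le_max_left _ _
    · exact (hR n).trans (le_max_right _ _)
  · rintro ⟨R, hR⟩
    exact ⟨R, fun n => hR (n + 1)⟩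

lemma continuous_qmap (c : ℂ) : Continuous (qmap c) := by unfold qmap; fun_prop

lemma differentiable_iterate_qmap (c : ℂ) (n : ℕ) : Differentiable ℂ (qmap c)^[n] := by
  have : Differentiable ℂ (qmap c) := by unfold qmap; fun_prop
  exact this.iterate n

lemma continuous_henon (c b : ℂ) : Continuous (henon c b) := by unfold henon; fun_prop

lemma continuous_henonInv (c b : ℂ) : Continuous (henonInv c b) := by
  unfold henonInv; fun_prop

lemma isClosed_Kset_qmap (c : ℂ) : IsClosed (Kset (qmap c)) :=
  isClosed_Kset (continuous_qmap c) (trapsBounded_qmap c)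

lemma norm_le_of_mem_Kset_qmap {c x : ℂ} (hx : x ∈ Kset (qmap c)) : ‖x‖ ≤ ‖c‖ + 3 :=
  norm_iterate_qmap_le hx 0

lemma Jset_qmap_nonempty (c : ℂ) : (Jset (qmap c)).Nonempty := by
  rw [Jset, nonempty_iff_ne_empty, Ne, frontier_eq_empty_iff, not_or]
  constructor
  · obtain ⟨s, hs⟩ := IsAlgClosed.exists_pow_nat_eq (1 - 4 * c) two_pos
    have hfix : qmap c ((1 + s) / 2) = (1 + s) / 2 := by
      simp only [qmap]; linear_combination hs / 4
    refine nonempty_iff_ne_empty.1 ⟨(1 + s) / 2, ‖(1 + s) / 2‖, fun n => ?_⟩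
    rw [Function.iterate_fixed hfix]
  · intro h
    have := norm_le_of_mem_Kset_qmap (h ▸ mem_univ ((‖c‖ + 4 : ℝ) : ℂ) : _ ∈ Kset (qmap c))
    rw [Complex.norm_real, Real.norm_of_nonneg (by positivity)] at this
    linarith

/-! ### Expanding invariant sets of the quadratic map -/

lemma Invariant.apply_mem_iff {α : Type*} {f : α → α} {S : Set α} (h : Invariant f S) {x : α} :
    f x ∈ S ↔ x ∈ S := by
  change x ∈ f ⁻¹' S ↔ _
  rw [show f ⁻¹' S = S from h]

lemma Invariant.iterate_mem_iff {α : Type*} {f : α → α} {S : Set α} (h : Invariant f S) (n : ℕ)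
    {x : α} : f^[n] x ∈ S ↔ x ∈ S := by
  induction n generalizing x with
  | zero => rfl
  | succ n ih => rw [Function.iterate_succ_apply, ih, h.apply_mem_iff]

lemma deriv_iterate_qmap_succ (c : ℂ) (n : ℕ) (x : ℂ) :
    deriv (qmap c)^[n + 1] x = deriv (qmap c)^[n] (qmap c x) * (2 * x) := by
  have h1 : HasDerivAt (qmap c) (2 * x) x := by
    have h : HasDerivAt (qmap c) (((2 : ℕ) : ℂ) * x ^ (2 - 1)) x := (hasDerivAt_pow 2 x).add_const c
    simpa using h
  have h2 := (differentiable_iterate_qmap c n (qmap c x)).hasDerivAt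
  exact (h2.comp x h1).deriv

/-- A weight `φ` with values in `[1, Φ]` on `Λ` such that `q` expands by the factor `μ` distances
between points that are `η`-close to a point of `Λ`, measured with the weight `φ` there. -/
structure IsAdapted (c : ℂ) (Λ : Set ℂ) (φ : ℂ → ℝ) (μ Φ η : ℝ) : Prop where
  one_lt : 1 < μ
  pos : 0 < η
  one_le : ∀ w ∈ Λ, 1 ≤ φ w
  le : ∀ w ∈ Λ, φ w ≤ Φ
  one_le_bound : 1 ≤ Φ
  expand : ∀ w ∈ Λ, ∀ x x', ‖x - w‖ ≤ η → ‖x' - w‖ ≤ η → μ * φ w ≤ φ (qmap c w) * ‖x + x'‖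

lemma exists_isAdapted {c : ℂ} {Λ : Set ℂ} (hcomp : IsCompact Λ) (hinv : Invariant (qmap c) Λ)
    (hexp : IsExpandingOn (qmap c) Λ) : ∃ φ μ Φ η, IsAdapted c Λ φ μ Φ η := by
  obtain ⟨C, hC, lam, hlam, hgrow⟩ := hexp
  set ν := (1 + lam) / 2 with hν
  have hν1 : 1 < ν := by linarith
  obtain ⟨m, hm1, hm⟩ : ∃ m : ℕ, 1 ≤ m ∧ ν ^ m ≤ C * lam ^ m := by
    have h1 : 1 < lam / ν := by rw [one_lt_div (by linarith)]; linarith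
    obtain ⟨m, hm, hm1⟩ := (((tendsto_pow_atTop_atTop_of_one_lt h1).eventually_ge_atTop
      (1 / C)).and (eventually_ge_atTop 1)).exists
    refine ⟨m, hm1, ?_⟩
    rw [div_pow, div_le_div_iff₀ hC (by positivity)] at hm
    linarith
  set D : ℕ → ℂ → ℝ := fun k w => ‖deriv (qmap c)^[k] w‖ with hD
  have hDsucc : ∀ k w, D (k + 1) w = D k (qmap c w) * ‖2 * w‖ := fun k w => by
    simp only [hD]; rw [deriv_iterate_qmap_succ, norm_mul]
  have hD0 : ∀ w, D 0 w = 1 := fun w => by simp [hD]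
  have hDcont : ∀ k, Continuous (D k) := fun k =>
    (((differentiable_iterate_qmap c k).contDiff (n := 1)).continuous_deriv le_rfl).norm
  set φ : ℂ → ℝ := fun w => ∑ k ∈ Finset.range m, D k w / ν ^ k with hφ
  have hφcont : Continuous φ :=
    continuous_finsetSum _ fun k _ => (hDcont k).div_const _
  have hone : ∀ w, 1 ≤ φ w := fun w => by
    have := Finset.single_le_sum (f := fun k => D k w / ν ^ k)
      (fun k _ => div_nonneg (norm_nonneg _) (by positivity)) (Finset.mem_range.2 hm1)
    simpa [hD0] using this
  obtain ⟨Φ, hΦ⟩ := hcomp.exists_bound_of_continuousOn hφcont.continuousOn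
  set Φ' := max Φ 1
  have hΦ1 : 1 ≤ Φ' := le_max_right _ _
  have hle : ∀ w ∈ Λ, φ w ≤ Φ' := fun w hw =>
    (le_abs_self _).trans ((hΦ w hw).trans (le_max_left _ _))
  have hstep : ∀ w ∈ Λ, ν * φ w ≤ φ (qmap c w) * ‖2 * w‖ := fun w hw => by
    have e1 : φ (qmap c w) * ‖2 * w‖ =
        ν * ∑ k ∈ Finset.range m, D (k + 1) w / ν ^ (k + 1) := by
      rw [hφ, Finset.sum_mul, Finset.mul_sum]
      refine Finset.sum_congr rfl fun k _ => ?_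
      rw [hDsucc, pow_succ]
      field_simp
    have e2 := Finset.sum_range_succ (fun k => D k w / ν ^ k) m
    rw [Finset.sum_range_succ', hD0] at e2
    have e3 : 1 ≤ D m w / ν ^ m := by
      rw [one_le_div (by positivity)]
      exact hm.trans (hgrow w hw m hm1)
    rw [e1]
    gcongr
    simp only [pow_zero, div_one] at e2
    change ∑ k ∈ Finset.range m, D k w / ν ^ k ≤ _
    linarith
  refine ⟨φ, (1 + ν) / 2, Φ', (ν - 1) / (4 * Φ'), by linarith,
    div_pos (by linarith) (by positivity), fun w _ => hone w, hle, hΦ1, ?_⟩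
  intro w hw x x' hx hx'
  have hηΦ : (ν - 1) / (4 * Φ') * Φ' = (ν - 1) / 4 := by field_simp
  set η := (ν - 1) / (4 * Φ')
  have h2w : ‖2 * w‖ ≤ ‖x + x'‖ + 2 * η := by
    have : 2 * w = (x + x') - ((x - w) + (x' - w)) := by ring
    rw [this]
    have h1 := norm_sub_le (x + x') ((x - w) + (x' - w))
    have h2 := norm_add_le (x - w) (x' - w)
    linarith
  have hq := hle _ (hinv.apply_mem_iff.2 hw)
  have hη : 0 ≤ η := (norm_nonneg _).trans hx
  have h3 : φ (qmap c w) * ‖2 * w‖ ≤ φ (qmap c w) * (‖x + x'‖ + 2 * η) := by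
    have := hone (qmap c w)
    gcongr
  have h4 : φ (qmap c w) * η ≤ Φ' * η := by gcongr
  have h5 := hstep w hw
  have h6 : (ν - 1) * 1 ≤ (ν - 1) * φ w := by
    have := hone w
    gcongr
  linarith

section Adapted

variable {c : ℂ} {Λ : Set ℂ} {φ : ℂ → ℝ} {μ Φ η : ℝ}

lemma IsAdapted.le_weight_mul (H : IsAdapted c Λ φ μ Φ η) {w : ℂ} (hw : w ∈ Λ) {t : ℝ}
    (ht : 0 ≤ t) : t ≤ φ w * t :=
  le_mul_of_one_le_left ht (H.one_le w hw)

lemma IsAdapted.weight_mul_le (H : IsAdapted c Λ φ μ Φ η) {w : ℂ} (hw : w ∈ Λ) {t : ℝ}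
    (ht : 0 ≤ t) : φ w * t ≤ Φ * t :=
  mul_le_mul_of_nonneg_right (H.le w hw) ht

lemma IsAdapted.pullback (H : IsAdapted c Λ φ μ Φ η) (hinv : Invariant (qmap c) Λ) {x z : ℂ}
    (hz : z ∈ Λ) (h : φ z * ‖qmap c x - z‖ ≤ η ^ 2) :
    ∃ w ∈ Λ, qmap c w = z ∧ μ * (φ w * ‖x - w‖) ≤ φ z * ‖qmap c x - z‖ := by
  obtain ⟨w, hwz, hle⟩ : ∃ w, qmap c w = z ∧ ‖x - w‖ ≤ ‖x + w‖ := by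
    obtain ⟨s, hs⟩ := IsAlgClosed.exists_pow_nat_eq (z - c) two_pos
    rcases le_total ‖x - s‖ ‖x + s‖ with h | h
    · exact ⟨s, by simp [qmap, hs], h⟩
    · exact ⟨-s, by simp [qmap, hs], by simpa [sub_eq_add_neg] using h⟩
  have hw : w ∈ Λ := hinv.apply_mem_iff.1 (hwz ▸ hz)
  have hfac : ‖qmap c x - z‖ = ‖x + w‖ * ‖x - w‖ := by
    rw [← norm_mul, ← hwz]
    congr 1
    simp only [qmap]; ring
  have hclose : ‖x - w‖ ≤ η := by
    refine le_of_sq_le_sq ?_ H.pos.le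
    have := H.le_weight_mul hz (norm_nonneg (qmap c x - z))
    have h3 : ‖x - w‖ * ‖x - w‖ ≤ ‖x + w‖ * ‖x - w‖ := by gcongr
    rw [sq]; linarith
  refine ⟨w, hw, hwz, ?_⟩
  have := H.expand w hw x w hclose (by simpa using H.pos.le)
  rw [hfac, ← hwz, ← mul_assoc, ← mul_assoc]
  gcongr

lemma IsAdapted.pullback_iterate (H : IsAdapted c Λ φ μ Φ η) (hinv : Invariant (qmap c) Λ)
    {x z : ℂ} (hz : z ∈ Λ) (n : ℕ) (h : φ z * ‖(qmap c)^[n] x - z‖ ≤ η ^ 2) :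
    ∃ w ∈ Λ, (qmap c)^[n] w = z ∧ φ w * ‖x - w‖ ≤ φ z * ‖(qmap c)^[n] x - z‖ := by
  induction n generalizing x with
  | zero => exact ⟨z, hz, rfl, le_rfl⟩
  | succ n ih =>
    rw [Function.iterate_succ_apply] at h
    obtain ⟨y, hy, hyz, hle⟩ := ih h
    obtain ⟨w, hw, hwy, hle'⟩ := H.pullback hinv hy (hle.trans h)
    refine ⟨w, hw, by rw [Function.iterate_succ_apply, hwy, hyz], ?_⟩
    have h0 := H.le_weight_mul hw (norm_nonneg (x - w))
    rw [Function.iterate_succ_apply]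
    nlinarith [H.one_lt, norm_nonneg (x - w)]

lemma IsAdapted.exists_le_norm_iterate_sub (H : IsAdapted c Λ φ μ Φ η)
    (hinv : Invariant (qmap c) Λ) {x z : ℂ} (hz : z ∈ Λ) {s : ℝ} (hs : 0 < s)
    (hno : ∀ n : ℕ, ∀ w ∈ Λ, (qmap c)^[n] w = z → 2 * s ≤ ‖w - x‖) :
    ∃ δ > 0, ∀ y, ‖y - x‖ ≤ s → ∀ n : ℕ, δ ≤ ‖(qmap c)^[n] y - z‖ := by
  have hΦ : 0 < Φ := one_pos.trans_le H.one_le_bound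
  have hη := H.pos
  refine ⟨min (η ^ 2) (s / 2) / Φ, by positivity, fun y hy n => ?_⟩
  by_contra! hlt
  rw [lt_div_iff₀ hΦ] at hlt
  have h1 := H.weight_mul_le hz (norm_nonneg ((qmap c)^[n] y - z))
  obtain ⟨w, hw, hwz, hle⟩ := H.pullback_iterate hinv hz n
    (x := y) (by linarith [min_le_left (η ^ 2) (s / 2)])
  have h2 := H.le_weight_mul hw (norm_nonneg (y - w))
  have h3 := hno n w hw hwz
  have h4 := norm_sub_le_norm_sub_add_norm_sub w y x
  rw [norm_sub_rev w y] at h4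
  linarith [min_le_right (η ^ 2) (s / 2)]

end Adapted

lemma differentiableOn_inv_iterate_sub {c z : ℂ} {U : Set ℂ} {δ : ℝ} (hδ : 0 < δ) {n : ℕ}
    (h : ∀ y ∈ U, δ ≤ ‖(qmap c)^[n] y - z‖) :
    DifferentiableOn ℂ (fun y => ((qmap c)^[n] y - z)⁻¹) U :=
  ((differentiable_iterate_qmap c n).sub_const z).differentiableOn.inv
    fun y hy => norm_pos_iff.1 (hδ.trans_le (h y hy))

lemma subset_Kset_of_invariant {c : ℂ} {Λ : Set ℂ} (hcomp : IsCompact Λ)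
    (hinv : Invariant (qmap c) Λ) : Λ ⊆ Kset (qmap c) := by
  intro x hx
  obtain ⟨R, hR⟩ := hcomp.isBounded.exists_norm_le
  exact ⟨R, fun n => hR _ ((hinv.iterate_mem_iff n).2 hx)⟩

lemma not_forall_pow_le {lam C M : ℝ} (hlam : 1 < lam) (hC : 0 < C) :
    ∃ n : ℕ, 1 ≤ n ∧ M < C * lam ^ n := by
  obtain ⟨n, h1, hn⟩ := (((tendsto_pow_atTop_atTop_of_one_lt hlam).eventually_gt_atTop
    (M / C)).and (eventually_ge_atTop 1)).exists
  exact ⟨n, hn, by rwa [div_lt_iff₀' hC] at h1⟩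

/-- Preimages of a point of an expanding completely invariant set are dense in the set. -/
lemma exists_preimage_near {c : ℂ} {Λ : Set ℂ} (hcomp : IsCompact Λ)
    (hinv : Invariant (qmap c) Λ) (hexp : IsExpandingOn (qmap c) Λ) {x z : ℂ} (hx : x ∈ Λ)
    (hz : z ∈ Λ) {s : ℝ} (hs : 0 < s) :
    ∃ n : ℕ, ∃ w ∈ Λ, (qmap c)^[n] w = z ∧ ‖w - x‖ < s := by
  by_contra! hno
  obtain ⟨φ, μ, Φ, η, H⟩ := exists_isAdapted hcomp hinv hexp
  obtain ⟨δ, hδ, hfar⟩ := H.exists_le_norm_iterate_sub hinv hz (half_pos hs) (x := x)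
    (fun n w hw hwz => by linarith [hno n w hw hwz])
  obtain ⟨C, hC, lam, hlam, hgrow⟩ := hexp
  set R := ‖c‖ + 3
  have hR : 0 < R := by positivity
  obtain ⟨n, hn1, hn⟩ := not_forall_pow_le (M := δ⁻¹ / (s / 2) * (2 * R) ^ 2) hlam hC
  have hd : HasDerivAt (fun y => ((qmap c)^[n] y - z)⁻¹)
      (-deriv (qmap c)^[n] x / ((qmap c)^[n] x - z) ^ 2) x :=
    ((differentiable_iterate_qmap c n x).hasDerivAt.sub_const z).fun_inv
      (norm_pos_iff.1 (hδ.trans_le (hfar x (by simp; positivity) n)))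
  have hbound : ‖deriv (fun y => ((qmap c)^[n] y - z)⁻¹) x‖ ≤ δ⁻¹ / (s / 2) := by
    refine Complex.norm_deriv_le_of_forall_mem_sphere_norm_le (half_pos hs)
      (DifferentiableOn.diffContOnCl_ball (U := closedBall x (s / 2)) ?_ Subset.rfl) ?_
    · exact differentiableOn_inv_iterate_sub hδ fun y hy => hfar y (mem_closedBall_iff_norm.1 hy) n
    · intro y hy
      rw [norm_inv]
      exact inv_anti₀ hδ (hfar y (mem_sphere_iff_norm.1 hy).le n)
  rw [hd.deriv, norm_div, norm_neg, norm_pow] at hbound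
  have h0 : 0 < ‖(qmap c)^[n] x - z‖ := hδ.trans_le (hfar x (by simp; positivity) n)
  have h1 : ‖(qmap c)^[n] x - z‖ ≤ 2 * R := by
    have := norm_sub_le ((qmap c)^[n] x) z
    have a := norm_iterate_qmap_le (subset_Kset_of_invariant hcomp hinv hx) n
    have b := norm_le_of_mem_Kset_qmap (subset_Kset_of_invariant hcomp hinv hz)
    linarith
  rw [div_le_iff₀ (by positivity)] at hbound
  have h2 : δ⁻¹ / (s / 2) * ‖(qmap c)^[n] x - z‖ ^ 2 ≤ δ⁻¹ / (s / 2) * (2 * R) ^ 2 := by gcongr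
  linarith [hgrow x hx n hn1]

lemma subset_Jset_of_isExpandingOn {c : ℂ} {Λ : Set ℂ} (hcomp : IsCompact Λ)
    (hinv : Invariant (qmap c) Λ) (hexp : IsExpandingOn (qmap c) Λ) : Λ ⊆ Jset (qmap c) := by
  intro x hx
  refine ⟨subset_closure (subset_Kset_of_invariant hcomp hinv hx), fun hint => ?_⟩
  obtain ⟨ρ, hρ, M, hM⟩ := exists_uniform_bound_of_mem_interior (trapsBounded_qmap c) hint
  obtain ⟨C, hC, lam, hlam, hgrow⟩ := hexp
  obtain ⟨n, hn1, hn⟩ := not_forall_pow_le (M := M / ρ) hlam hC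
  have := norm_hasDerivAt_le (differentiable_iterate_qmap c n) hρ (fun t ht => hM t ht n)
    (differentiable_iterate_qmap c n x).hasDerivAt
  linarith [hgrow x hx n hn1]

lemma two_pow_le_norm_iterate_qmap {c x : ℂ} (hx : ‖c‖ + 3 ≤ ‖x‖) (n : ℕ) :
    2 ^ n ≤ ‖(qmap c)^[n] x‖ ∧ ‖c‖ + 3 ≤ ‖(qmap c)^[n] x‖ := by
  induction n with
  | zero => exact ⟨by simp; linarith [norm_nonneg c], hx⟩
  | succ n ih =>
    rw [Function.iterate_succ_apply']
    set y := (qmap c)^[n] x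
    have h1 : ‖y‖ ^ 2 - ‖c‖ ≤ ‖qmap c y‖ := by
      have := norm_sub_norm_le (y ^ 2) (-c)
      rwa [norm_pow, norm_neg, sub_neg_eq_add] at this
    have h2 : 2 * ‖y‖ ≤ ‖qmap c y‖ := by nlinarith [norm_nonneg c]
    exact ⟨by rw [pow_succ]; linarith, by linarith [norm_nonneg c]⟩

lemma exists_uniform_escape {c y : ℂ} (hy : y ∉ Kset (qmap c)) :
    ∃ t > 0, ∀ A : ℝ, ∀ᶠ n : ℕ in atTop, ∀ x, ‖x - y‖ ≤ t → A ≤ ‖(qmap c)^[n] x‖ := by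
  simp only [Kset, mem_ofPred_eq, not_exists, not_forall, not_le] at hy
  obtain ⟨N, hN⟩ := hy (‖c‖ + 3)
  have hopen : IsOpen {x | ‖c‖ + 3 < ‖(qmap c)^[N] x‖} :=
    isOpen_lt continuous_const ((continuous_qmap c).iterate N).norm
  obtain ⟨t, ht, hsub⟩ := Metric.nhds_basis_closedBall.mem_iff.1 (hopen.mem_nhds hN)
  refine ⟨t, ht, fun A => ?_⟩
  have h2 : Tendsto (fun n : ℕ => (2 : ℝ) ^ (n - N)) atTop atTop :=
    (tendsto_pow_atTop_atTop_of_one_lt (one_lt_two : (1 : ℝ) < 2)).comp (tendsto_sub_atTop_nat N)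
  filter_upwards [h2.eventually_ge_atTop A, eventually_ge_atTop N] with n hn hnN x hx
  have := (two_pow_le_norm_iterate_qmap (hsub (mem_closedBall_iff_norm.2 hx) : _ < _).le
    (n - N)).1
  rw [← Function.iterate_add_apply, Nat.sub_add_cancel hnN] at this
  linarith

/-- A uniformly bounded sequence of holomorphic functions on a disc that converges to `0`
uniformly near the center converges to `0` at every point of the disc. -/
lemma tendsto_zero_of_tendsto_zero_near_center {f : ℕ → ℂ → ℂ} {y x : ℂ} {r ρ t M : ℝ}
    (hf : ∀ n, DifferentiableOn ℂ (f n) (ball y r)) (hM : ∀ n, ∀ z ∈ ball y r, ‖f n z‖ ≤ M)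
    (hxρ : ‖x - y‖ < ρ) (hρr : ρ < r) (ht : 0 < t)
    (h0 : ∀ ε > 0, ∀ᶠ n in atTop, ∀ z, ‖z - y‖ ≤ t → ‖f n z‖ ≤ ε) :
    Tendsto (fun n => f n x) atTop (𝓝 0) := by
  have hρ : 0 < ρ := (norm_nonneg _).trans_lt hxρ
  have hcoef : ∀ n k s ε, 0 < s → s < r → (∀ z, ‖z - y‖ = s → ‖f n z‖ ≤ ε) →
      ‖((k.factorial : ℂ))⁻¹ • (x - y) ^ k • iteratedDeriv k (f n) y‖ ≤
        ε * (‖x - y‖ / s) ^ k := fun n k s ε hs hsr h => by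
    have h1 := Complex.norm_iteratedDeriv_le_of_forall_mem_sphere_norm_le k hs
      ((hf n).diffContOnCl_ball (closedBall_subset_ball hsr))
      (fun z hz => h z (mem_sphere_iff_norm.1 hz))
    rw [norm_smul, norm_smul, norm_inv, norm_pow, Complex.norm_natCast]
    have hfac : (0 : ℝ) < k.factorial := by positivity
    calc _ ≤ ((k.factorial : ℝ))⁻¹ * (‖x - y‖ ^ k * (k.factorial * ε / s ^ k)) := by gcongr
      _ = _ := by rw [div_pow]; field_simp
  have hsum : ∀ n, f n x =
      ∑' k : ℕ, ((k.factorial : ℂ))⁻¹ • (x - y) ^ k • iteratedDeriv k (f n) y := fun n =>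
    (Complex.hasSum_taylorSeries_on_ball (hf n)
      (mem_ball_iff_norm.2 (hxρ.trans hρr))).tsum_eq.symm
  simp_rw [hsum]
  rw [← tsum_zero (L := SummationFilter.unconditional ℕ)]
  refine tendsto_tsum_of_dominated_convergence (bound := fun k => M * (‖x - y‖ / ρ) ^ k)
    ?_ (fun k => ?_) (Eventually.of_forall fun n k => ?_)
  · exact (summable_geometric_of_lt_one (by positivity) ((div_lt_one hρ).2 hxρ)).mul_left M
  · set s := min t ρ with hs
    have hs0 : 0 < s := lt_min ht hρ
    rw [Metric.tendsto_atTop']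
    intro ε hε
    set A := (‖x - y‖ / s) ^ k
    have hA : 0 ≤ A := by positivity
    obtain ⟨N, hN⟩ := eventually_atTop.1 (h0 (ε / (A + 1)) (by positivity))
    refine ⟨N, fun n hn => ?_⟩
    rw [dist_zero_right]
    refine (hcoef n k s (ε / (A + 1)) hs0 ((min_le_right _ _).trans_lt hρr)
      fun z hz => hN n hn.le z (hz.le.trans (min_le_left _ _))).trans_lt ?_
    rw [div_mul_eq_mul_div, div_lt_iff₀ (by positivity)]
    change ε * A < _
    nlinarith
  · exact hcoef n k ρ M hρ hρr fun z hz =>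
      hM n z (mem_ball_iff_norm.2 (hz.trans_lt hρr))

lemma Jset_subset_of_isExpandingOn {c : ℂ} {Λ : Set ℂ} (hcomp : IsCompact Λ)
    (hinv : Invariant (qmap c) Λ) (hexp : IsExpandingOn (qmap c) Λ) (hne : Λ.Nonempty) :
    Jset (qmap c) ⊆ Λ := by
  intro x hx
  by_contra hxΛ
  obtain ⟨φ, μ, Φ, η, H⟩ := exists_isAdapted hcomp hinv hexp
  obtain ⟨z, hz⟩ := hne
  obtain ⟨r, hr, hball⟩ := Metric.isOpen_iff.1 hcomp.isClosed.isOpen_compl x hxΛ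
  set s := r / 2 with hs_def
  have hs : 0 < s := half_pos hr
  obtain ⟨δ, hδ, hfar⟩ := H.exists_le_norm_iterate_sub hinv hz hs (x := x) fun n w hw _ => by
    by_contra! h
    exact hball (mem_ball_iff_norm.2 (by linarith)) hw
  rw [Jset, frontier_eq_closure_inter_closure] at hx
  obtain ⟨y, hy, hxy⟩ := Metric.mem_closure_iff.1 hx.2 (s / 4) (by positivity)
  rw [dist_eq_norm] at hxy
  obtain ⟨t, ht, hesc⟩ := exists_uniform_escape hy
  have hsub : ∀ w ∈ ball y (3 * s / 4), ‖w - x‖ ≤ s := fun w hw => by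
    have h1 := mem_ball_iff_norm.1 hw
    have h2 := norm_sub_le_norm_sub_add_norm_sub w y x
    rw [norm_sub_rev y x] at h2
    linarith
  have hlim := tendsto_zero_of_tendsto_zero_near_center
    (f := fun n y => ((qmap c)^[n] y - z)⁻¹) (y := y) (x := x) (r := 3 * s / 4) (ρ := s / 2)
    (t := t) (M := δ⁻¹)
    (fun n => differentiableOn_inv_iterate_sub hδ fun w hw => hfar w (hsub w hw) n)
    (fun n w hw => by rw [norm_inv]; exact inv_anti₀ hδ (hfar w (hsub w hw) n))
    (by linarith) (by linarith) ht (fun ε hε => by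
      filter_upwards [hesc (ε⁻¹ + ‖z‖)] with n hn w hw
      rw [norm_inv, inv_le_comm₀ _ hε]
      · linarith [hn w hw, norm_sub_norm_le ((qmap c)^[n] w) z]
      · linarith [hn w hw, norm_sub_norm_le ((qmap c)^[n] w) z, inv_pos.2 hε])
  set R := ‖c‖ + 3 with hR
  have hR0 : 0 < R := by positivity
  have hxK : x ∈ Kset (qmap c) := (isClosed_Kset_qmap c).closure_eq ▸ hx.1
  have hzK := subset_Kset_of_invariant hcomp hinv hz
  obtain ⟨n, hn⟩ := (hlim.norm.eventually_lt_const
    (by simp only [norm_zero]; positivity : ‖(0 : ℂ)‖ < (2 * R)⁻¹)).exists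
  rw [norm_inv, inv_lt_inv₀ (hδ.trans_le (hfar x (by simpa using hs.le) n)) (by positivity)] at hn
  linarith [norm_sub_le ((qmap c)^[n] x) z, norm_iterate_qmap_le hxK n,
    norm_le_of_mem_Kset_qmap hzK]

/-! ### Shadowing -/

/-- First coordinates of a bi-infinite orbit of the Hénon map. -/
def IsHenonOrbit (c b : ℂ) (x : ℤ → ℂ) : Prop :=
  ∀ n, x (n + 1) = qmap c (x n) - b * x (n - 1)

/-- Bi-infinite orbits of `q` in `Λ`. -/
def IsOrbitIn (c : ℂ) (Λ : Set ℂ) (w : ℤ → ℂ) : Prop :=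
  ∀ n, w n ∈ Λ ∧ qmap c (w n) = w (n + 1)

lemma IsOrbitIn.isHenonOrbit {c : ℂ} {Λ : Set ℂ} {w : ℤ → ℂ} (h : IsOrbitIn c Λ w) :
    IsHenonOrbit c 0 w := fun n => by rw [zero_mul, sub_zero, (h n).2]

lemma IsOrbitIn.shift {c : ℂ} {Λ : Set ℂ} {w : ℤ → ℂ} (h : IsOrbitIn c Λ w) (p : ℤ) :
    IsOrbitIn c Λ (fun n => w (n + p)) := fun n =>
  ⟨(h _).1, by rw [(h _).2, add_right_comm]⟩

lemma IsOrbitIn.iterate_eq {c : ℂ} {Λ : Set ℂ} {w : ℤ → ℂ} (h : IsOrbitIn c Λ w) (n : ℕ) :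
    (qmap c)^[n] (w 0) = w n := by
  induction n with
  | zero => rfl
  | succ n ih => rw [Function.iterate_succ_apply', ih, (h n).2]; push_cast; rfl

section Adapted

variable {c : ℂ} {Λ : Set ℂ} {φ : ℂ → ℝ} {μ Φ η : ℝ}

/-- Expansivity: orbits that stay near the same orbit in `Λ` coincide. -/
lemma IsAdapted.orbit_unique (H : IsAdapted c Λ φ μ Φ η) {b : ℂ} (hb : 1 + Φ * ‖b‖ < μ)
    {v x x' : ℤ → ℂ} (hv : IsOrbitIn c Λ v) (hx : IsHenonOrbit c b x)
    (hx' : IsHenonOrbit c b x') (h : ∀ n, ‖x n - v n‖ ≤ η) (h' : ∀ n, ‖x' n - v n‖ ≤ η) :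
    x = x' := by
  have hΦ : 0 ≤ Φ := zero_le_one.trans H.one_le_bound
  set e : ℤ → ℝ := fun n => φ (v n) * ‖x n - x' n‖ with he
  have hde : ∀ n, ‖x n - x' n‖ ≤ e n := fun n => H.le_weight_mul (hv n).1 (norm_nonneg _)
  have hbdd : BddAbove (range e) := by
    refine ⟨Φ * (2 * η), ?_⟩
    rintro _ ⟨n, rfl⟩
    refine (H.weight_mul_le (hv n).1 (norm_nonneg _)).trans ?_
    have := norm_sub_le_norm_sub_add_norm_sub (x n) (v n) (x' n)
    rw [norm_sub_rev (v n)] at this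
    gcongr
    linarith [h n, h' n]
  have hrec : ∀ n, μ * e n ≤ e (n + 1) + Φ * ‖b‖ * e (n - 1) := fun n => by
    have h1 := H.expand (v n) (hv n).1 (x n) (x' n) (h n) (h' n)
    rw [(hv n).2] at h1
    have h2 : (x n + x' n) * (x n - x' n) =
        (x (n + 1) - x' (n + 1)) + b * (x (n - 1) - x' (n - 1)) := by
      rw [hx n, hx' n]; simp only [qmap]; ring
    have h3 : ‖x n + x' n‖ * ‖x n - x' n‖ ≤
        ‖x (n + 1) - x' (n + 1)‖ + ‖b‖ * ‖x (n - 1) - x' (n - 1)‖ := by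
      rw [← norm_mul, ← norm_mul, h2]
      exact norm_add_le _ _
    have hpos : 0 ≤ φ (v (n + 1)) := zero_le_one.trans (H.one_le _ (hv _).1)
    calc μ * e n = μ * φ (v n) * ‖x n - x' n‖ := by rw [he]; ring
      _ ≤ φ (v (n + 1)) * ‖x n + x' n‖ * ‖x n - x' n‖ := by gcongr
      _ = φ (v (n + 1)) * (‖x n + x' n‖ * ‖x n - x' n‖) := by ring
      _ ≤ φ (v (n + 1)) *
          (‖x (n + 1) - x' (n + 1)‖ + ‖b‖ * ‖x (n - 1) - x' (n - 1)‖) := by gcongr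
      _ = e (n + 1) + φ (v (n + 1)) * (‖b‖ * ‖x (n - 1) - x' (n - 1)‖) := by rw [he]; ring
      _ ≤ e (n + 1) + Φ * (‖b‖ * e (n - 1)) := by
        have := H.le _ (hv (n + 1)).1
        have := hde (n - 1)
        gcongr
      _ = _ := by ring
  set M := ⨆ n, e n
  have hle : ∀ n, e n ≤ M := fun n => le_ciSup hbdd n
  have hμ := H.one_lt
  by_contra hne
  obtain ⟨m, hm⟩ := Function.ne_iff.1 hne
  have hM : 0 < M := (norm_pos_iff.2 (sub_ne_zero.2 hm)).trans_le ((hde m).trans (hle m))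
  have hlt : (1 + Φ * ‖b‖) * M / μ < M := by
    rw [div_lt_iff₀ (by linarith), mul_comm M]
    gcongr
  obtain ⟨n, hn⟩ := exists_lt_of_lt_ciSup hlt
  rw [div_lt_iff₀ (by linarith)] at hn
  have h1 : Φ * ‖b‖ * e (n - 1) ≤ Φ * ‖b‖ * M := by
    have := hle (n - 1)
    gcongr
  linarith [hrec n, hle (n + 1)]

lemma IsAdapted.shadow_unique (H : IsAdapted c Λ φ μ Φ η) {v w x : ℤ → ℂ} {r : ℝ}
    (hr : 2 * r ≤ η) (hv : IsOrbitIn c Λ v) (hw : IsOrbitIn c Λ w)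
    (h : ∀ n, ‖x n - v n‖ ≤ r) (h' : ∀ n, ‖x n - w n‖ ≤ r) : v = w := by
  refine H.orbit_unique (b := 0) (by simpa using H.one_lt) hv hv.isHenonOrbit hw.isHenonOrbit
    (fun n => by simpa using H.pos.le) (fun n => ?_)
  have := norm_sub_le_norm_sub_add_norm_sub (w n) (x n) (v n)
  rw [norm_sub_rev (w n) (x n)] at this
  linarith [h n, h' n]

lemma IsAdapted.exists_shadow (H : IsAdapted c Λ φ μ Φ η) (hcomp : IsCompact Λ)
    (hinv : Invariant (qmap c) Λ) {r β : ℝ} (hr : μ * r ≤ η ^ 2) (hβ : Φ * β ≤ (μ - 1) * r)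
    {x : ℤ → ℂ} (hx : ∀ n, ‖x (n + 1) - qmap c (x n)‖ ≤ β)
    (hnear : ∀ n, ∃ w ∈ Λ, φ w * ‖x n - w‖ ≤ r) :
    ∃ v, IsOrbitIn c Λ v ∧ ∀ n, ‖x n - v n‖ ≤ r := by
  have hback : ∀ n, ∀ z ∈ Λ, φ z * ‖x (n + 1) - z‖ ≤ r →
      ∃ w ∈ Λ, qmap c w = z ∧ φ w * ‖x n - w‖ ≤ r := fun n z hz hzr => by
    have hpos : 0 ≤ φ z := zero_le_one.trans (H.one_le _ hz)
    have h1 : φ z * ‖qmap c (x n) - z‖ ≤ μ * r := by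
      have h2 := norm_sub_le_norm_sub_add_norm_sub (qmap c (x n)) (x (n + 1)) z
      rw [norm_sub_rev (qmap c (x n)) (x (n + 1))] at h2
      have h3 := H.weight_mul_le hz (norm_nonneg (x (n + 1) - qmap c (x n)))
      have h4 : Φ * ‖x (n + 1) - qmap c (x n)‖ ≤ Φ * β := by
        have := H.one_le_bound
        gcongr
        exact hx n
      nlinarith
    obtain ⟨w, hw, hwz, hle⟩ := H.pullback hinv hz (h1.trans hr)
    exact ⟨w, hw, hwz, le_of_mul_le_mul_left (hle.trans h1) (by linarith [H.one_lt])⟩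
  choose! pre hpreΛ hpreq hprer using hback
  choose near hnearΛ hnearr using hnear
  let C : ℕ → Set (ℤ → ℂ) := fun N => {w | (∀ n, w n ∈ Λ) ∧ (∀ n, ‖x n - w n‖ ≤ r) ∧
    ∀ n < (N : ℤ), qmap c (w n) = w (n + 1)}
  have hclosed : ∀ N, IsClosed (C N) := fun N => by
    simp only [C, ofPred_and, ofPred_forall]
    refine IsClosed.inter (isClosed_iInter fun n => hcomp.isClosed.preimage (continuous_apply n))
      (IsClosed.inter (isClosed_iInter fun n => isClosed_le (by fun_prop) continuous_const)
        (isClosed_iInter fun n => isClosed_iInter fun _ => isClosed_eq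
          ((continuous_qmap c).comp (continuous_apply n)) (continuous_apply _)))
  have hcompact : IsCompact (C 0) :=
    (isCompact_univ_pi fun _ : ℤ => hcomp).of_isClosed_subset (hclosed 0)
      fun w hw n _ => hw.1 n
  have hnonempty : ∀ N, (C N).Nonempty := fun N => by
    let u : ℕ → ℂ := fun k => Nat.rec (near N) (fun k z => pre (N - (k + 1)) z) k
    have hu0 : u 0 = near N := rfl
    have husucc : ∀ k : ℕ, u (k + 1) = pre (N - (k + 1)) (u k) := fun k => rfl
    have hu : ∀ k : ℕ, u k ∈ Λ ∧ φ (u k) * ‖x (N - k) - u k‖ ≤ r := fun k => by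
      induction k with
      | zero => simpa [hu0] using ⟨hnearΛ N, hnearr N⟩
      | succ k ih =>
        have e : (N : ℤ) - k = N - (k + 1) + 1 := by ring
        rw [e] at ih
        rw [husucc]
        push_cast
        exact ⟨hpreΛ _ _ ih.1 ih.2, hprer _ _ ih.1 ih.2⟩
    have huq : ∀ k : ℕ, qmap c (u (k + 1)) = u k := fun k => by
      have e : (N : ℤ) - k = N - (k + 1) + 1 := by ring
      have ih := hu k
      rw [e] at ih
      exact hpreq _ _ ih.1 ih.2
    refine ⟨fun n => if n ≤ N then u (N - n).toNat else near n, fun n => ?_, fun n => ?_,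
      fun n hn => ?_⟩
    · dsimp only
      split_ifs
      · exact (hu _).1
      · exact hnearΛ n
    · dsimp only
      split_ifs with hn
      · have h1 := hu (N - n).toNat
        rw [Int.toNat_of_nonneg (by linarith), _root_.sub_sub_cancel] at h1
        exact (H.le_weight_mul h1.1 (norm_nonneg _)).trans h1.2
      · exact (H.le_weight_mul (hnearΛ n) (norm_nonneg _)).trans (hnearr n)
    · dsimp only
      rw [if_pos hn.le, if_pos (by omega),
        show ((N : ℤ) - n).toNat = (N - (n + 1)).toNat + 1 by omega]
      exact huq _
  obtain ⟨v, hv⟩ := IsCompact.nonempty_iInter_of_sequence_nonempty_isCompact_isClosed C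
    (fun N w hw => ⟨hw.1, hw.2.1, fun n hn => hw.2.2 n (by push_cast; omega)⟩)
    hnonempty hcompact hclosed
  rw [mem_iInter] at hv
  exact ⟨v, fun n => ⟨(hv 0).1 n, (hv (n + 1).toNat).2.2 n (by omega)⟩, (hv 0).2.1⟩

lemma IsAdapted.exists_periodic_near (H : IsAdapted c Λ φ μ Φ η) (hcomp : IsCompact Λ)
    (hinv : Invariant (qmap c) Λ) (hexp : IsExpandingOn (qmap c) Λ) {r : ℝ} (hr0 : 0 < r)
    (hr : μ * r ≤ η ^ 2) (h2r : 2 * r ≤ η) {v : ℤ → ℂ} (hv : IsOrbitIn c Λ v) (L : ℕ) :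
    ∃ p : ℕ, 0 < p ∧ ∃ w, IsOrbitIn c Λ w ∧ Function.Periodic w (p : ℤ) ∧
      ∀ n : ℕ, n ≤ L → ‖v n - w n‖ ≤ r := by
  have hΦ : 0 < Φ := one_pos.trans_le H.one_le_bound
  have hμ := sub_pos.2 H.one_lt
  set β := (μ - 1) * r / Φ
  have hβ : 0 < β := by positivity
  obtain ⟨k, u, huΛ, hku, hu⟩ :=
    exists_preimage_near hcomp hinv hexp (hv (L + 1)).1 (hv 0).1 hβ
  let p := L + 1 + k
  let Y : ℕ → ℂ := fun j => if j ≤ L then v j else (qmap c)^[j - (L + 1)] u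
  have hYΛ : ∀ j, Y j ∈ Λ := fun j => by
    simp only [Y]
    split_ifs
    · exact (hv _).1
    · exact (hinv.iterate_mem_iff _).2 huΛ
  have hYp : Y p = Y 0 := by
    simp only [Y, p]
    rw [if_neg (by omega), if_pos (Nat.zero_le _), show L + 1 + k - (L + 1) = k by omega]
    exact hku
  have hY : ∀ j, ‖Y (j + 1) - qmap c (Y j)‖ ≤ β := fun j => by
    rcases lt_trichotomy j L with hj | hj | hj
    · simp only [Y]
      rw [if_pos hj.le, if_pos (by omega), (hv _).2]
      simpa using hβ.le
    · subst hj
      simp only [Y]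
      rw [if_pos le_rfl, if_neg (by omega), (hv _).2]
      simpa using hu.le
    · simp only [Y]
      rw [if_neg (by omega), if_neg (by omega), ← Function.iterate_succ_apply' (qmap c),
        show j + 1 - (L + 1) = j - (L + 1) + 1 by omega]
      simpa using hβ.le
  have hp : 0 < p := by omega
  let x : ℤ → ℂ := fun n => Y (n % p).toNat
  have hxp : Function.Periodic x (p : ℤ) := fun n => by simp [x]
  have hxsucc : ∀ n, x (n + 1) = Y ((n % p).toNat + 1) := fun n => by
    have h1 := Int.emod_nonneg n (by omega : (p : ℤ) ≠ 0)
    have h2 := Int.emod_lt_of_pos n (by omega : (0 : ℤ) < p)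
    have h3 : (n + 1) % p = (n % p + 1) % p := by simp
    simp only [x]
    rw [h3]
    rcases (by omega : n % p + 1 < p ∨ n % p + 1 = p) with h4 | h4
    · rw [Int.emod_eq_of_lt (by omega) h4]
      congr 1
      omega
    · rw [h4, Int.emod_self, show (n % p).toNat + 1 = p by omega, hYp]
      rfl
  obtain ⟨w, hw, hxw⟩ := H.exists_shadow hcomp hinv (β := β) hr (by simp only [β]; field_simp; rfl)
    (x := x) (fun n => by rw [hxsucc]; exact hY _)
    (fun n => ⟨x n, hYΛ _, by simpa using hr0.le⟩)
  refine ⟨p, hp, w, hw, fun n => ?_, fun n hn => ?_⟩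
  · have := H.shadow_unique h2r (hw.shift p) hw (x := x) (fun n => ?_) hxw
    · exact congrFun this n
    · rw [← hxp n]; exact hxw _
  · have := hxw n
    simp only [x] at this
    rwa [Int.emod_eq_of_lt (by omega) (by omega), Int.toNat_natCast, show Y n = v n from if_pos hn]
      at this

end Adapted

lemma finite_periodic_orbits (c : ℂ) (Λ : Set ℂ) {p : ℕ} (hp : 0 < p) :
    {w | IsOrbitIn c Λ w ∧ Function.Periodic w (p : ℤ)}.Finite := by
  have hroots : {x | (qmap c)^[p] x = x}.Finite := by
    let P : Polynomial ℂ := Polynomial.X ^ 2 + Polynomial.C c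
    have hdeg : (P.comp^[p] Polynomial.X).natDegree = 2 ^ p := by
      rw [Polynomial.natDegree_iterate_comp, Polynomial.natDegree_X_pow_add_C]
      simp
    have hne : P.comp^[p] Polynomial.X - Polynomial.X ≠ 0 := fun h => by
      rw [sub_eq_zero.1 h, Polynomial.natDegree_X] at hdeg
      have := Nat.one_lt_two_pow hp.ne'
      omega
    refine (Polynomial.finite_setOfPred_isRoot hne).subset fun x hx => ?_
    have heval : ∀ n, (P.comp^[n] Polynomial.X).eval x = (qmap c)^[n] x := fun n => by
      rw [Polynomial.iterate_comp_eval, Polynomial.eval_X]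
      congr 1
      ext y
      simp [P, qmap]
    have hx : (qmap c)^[p] x = x := hx
    change Polynomial.eval x _ = 0
    rw [Polynomial.eval_sub, heval, hx, Polynomial.eval_X, sub_self]
  refine Set.Finite.of_finite_image (f := fun w => w 0) (hroots.subset ?_) ?_
  · rintro _ ⟨w, ⟨hw, hper⟩, rfl⟩
    change (qmap c)^[p] (w 0) = w 0
    rw [hw.iterate_eq, ← zero_add (p : ℤ), hper 0]
  · rintro w ⟨hw, hper⟩ w' ⟨hw', hper'⟩ h0
    have h0 : w 0 = w' 0 := h0
    ext n
    rw [← hper.int_mul |n| n, ← hper'.int_mul |n| n]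
    have hnonneg : 0 ≤ n + |n| * p := by
      have h1 := neg_abs_le n
      have h2 : |n| * 1 ≤ |n| * p := by gcongr; omega
      omega
    obtain ⟨m, hm⟩ := Int.eq_ofNat_of_zero_le hnonneg
    simp only [Int.cast_id]
    rw [hm, ← hw.iterate_eq, ← hw'.iterate_eq, h0]

/-! ### The Hénon map as a homeomorphism -/

lemma henon_henonInv {c b : ℂ} (hb : b ≠ 0) (p : ℂ × ℂ) : henon c b (henonInv c b p) = p := by
  ext
  · simp only [henon, henonInv]; field_simp; ring
  · rfl

lemma henonInv_henon {c b : ℂ} (hb : b ≠ 0) (p : ℂ × ℂ) : henonInv c b (henon c b p) = p := by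
  ext
  · rfl
  · simp only [henon, henonInv]; field_simp; ring

/-- The Hénon map with `b ≠ 0` as a homeomorphism. -/
def henonHomeo (c : ℂ) {b : ℂ} (hb : b ≠ 0) : (ℂ × ℂ) ≃ₜ (ℂ × ℂ) where
  toFun := henon c b
  invFun := henonInv c b
  left_inv := henonInv_henon hb
  right_inv := henon_henonInv hb
  continuous_toFun := continuous_henon c b
  continuous_invFun := continuous_henonInv c b

lemma invariant_henonJulia (c : ℂ) {b : ℂ} (hb : b ≠ 0) :
    Invariant (henon c b) (henonJulia c b) := by
  have h1 : henonHomeo c hb ⁻¹' Kset (henon c b) = Kset (henon c b) :=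
    ext fun p => image_mem_Kset_iff
  have h2 : henonHomeo c hb ⁻¹' Kset (henonInv c b) = Kset (henonInv c b) := ext fun p => by
    rw [mem_preimage, ← image_mem_Kset_iff]
    exact iff_of_eq (congrArg (· ∈ _) (henonInv_henon hb p))
  change henonHomeo c hb ⁻¹' _ = _
  rw [henonJulia, preimage_inter, Jset, Jset, (henonHomeo c hb).preimage_frontier,
    (henonHomeo c hb).preimage_frontier, h1, h2]

lemma IsHenonOrbit.henon_apply {c b : ℂ} {x : ℤ → ℂ} (hx : IsHenonOrbit c b x) (n : ℤ) :
    henon c b (x n, x (n - 1)) = (x (n + 1), x n) := by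
  simp only [henon, hx n, qmap]

lemma IsHenonOrbit.iterate_henon {c b : ℂ} {x : ℤ → ℂ} (hx : IsHenonOrbit c b x) (n : ℕ) :
    (henon c b)^[n] (x 0, x (-1)) = (x n, x (n - 1)) := by
  induction n with
  | zero => rfl
  | succ n ih => rw [Function.iterate_succ_apply', ih, hx.henon_apply]; push_cast; simp

lemma IsHenonOrbit.iterate_henonInv {c b : ℂ} (hb : b ≠ 0) {x : ℤ → ℂ} (hx : IsHenonOrbit c b x)
    (n : ℕ) : (henonInv c b)^[n] (x 0, x (-1)) = (x (-n), x (-n - 1)) := by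
  induction n with
  | zero => rfl
  | succ n ih =>
    have h := hx.henon_apply (-n - 1)
    rw [sub_add_cancel] at h
    rw [Function.iterate_succ_apply', ih, ← h, henonInv_henon hb]
    push_cast
    ring_nf

lemma isHenonOrbit_fst {c b : ℂ} {P : ℤ → ℂ × ℂ} (hP : ∀ n, P (n + 1) = henon c b (P n)) :
    IsHenonOrbit c b (fun n => (P n).1) ∧ ∀ n, ((P n).1, (P (n - 1)).1) = P n := by
  have hsnd : ∀ n, (P n).2 = (P (n - 1)).1 := fun n => by
    have := hP (n - 1)
    rw [sub_add_cancel] at this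
    rw [this]; rfl
  refine ⟨fun n => ?_, fun n => by rw [← hsnd]⟩
  change (P (n + 1)).1 = qmap c (P n).1 - b * (P (n - 1)).1
  rw [hP, ← hsnd]; rfl

lemma Invariant.exists_isHenonOrbit {c b : ℂ} (hb : b ≠ 0) {S : Set (ℂ × ℂ)}
    (hS : Invariant (henon c b) S) {z : ℂ × ℂ} (hz : z ∈ S) :
    ∃ x, (x 0, x (-1)) = z ∧ IsHenonOrbit c b x ∧ ∀ n, (x n, x (n - 1)) ∈ S := by
  let e : Equiv.Perm (ℂ × ℂ) := (henonHomeo c hb).toEquiv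
  let P : ℤ → ℂ × ℂ := fun n => (e ^ n) z
  have hP : ∀ n, P (n + 1) = henon c b (P n) := fun n => by
    simp only [P]
    rw [add_comm, zpow_one_add]
    rfl
  obtain ⟨horb, hpair⟩ := isHenonOrbit_fst hP
  refine ⟨_, hpair 0, horb, fun n => ?_⟩
  rw [hpair]
  induction n with
  | zero => exact hz
  | succ n ih => rw [hP]; exact hS.apply_mem_iff.2 ih
  | pred n ih =>
    rw [← hS.apply_mem_iff, ← hP, sub_add_cancel]
    exact ih

lemma IsHenonOrbit.norm_le {c b : ℂ} (hb : ‖b‖ ≤ 1) {x : ℤ → ℂ} (hx : IsHenonOrbit c b x) {B : ℝ}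
    (hB : ∀ n, ‖x n‖ ≤ B) (n : ℤ) : ‖x n‖ ≤ ‖c‖ + 3 := by
  have := le_max_of_sq_le (fun n => ‖x n‖) (R := 0) (norm_nonneg c) hB (fun n => ?_) n
  · simpa [max_eq_right (by positivity : (0 : ℝ) ≤ ‖c‖ + 3)] using this
  · refine Or.inr ⟨n + 1, n - 1, ?_⟩
    have e : x n ^ 2 = x (n + 1) + b * x (n - 1) - c := by rw [hx n, qmap]; ring
    rw [← norm_pow, e]
    refine (norm_sub_le _ _).trans ?_
    have := norm_add_le (x (n + 1)) (b * x (n - 1))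
    rw [norm_mul] at this
    nlinarith [norm_nonneg (x (n - 1))]

lemma henonJulia_subset {c b : ℂ} (hb0 : b ≠ 0) (hb : ‖b‖ ≤ 1) :
    henonJulia c b ⊆ Kset (henon c b) ∩ Kset (henonInv c b) :=
  inter_subset_inter
    (isClosed_Kset (continuous_henon c b) (trapsBounded_henon hb)).frontier_subset
    (isClosed_Kset (continuous_henonInv c b) (trapsBounded_henonInv hb0 hb)).frontier_subset

lemma exists_isHenonOrbit_of_mem_henonJulia {c b : ℂ} (hb0 : b ≠ 0) (hb : ‖b‖ ≤ 1) {z : ℂ × ℂ}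
    (hz : z ∈ henonJulia c b) : ∃ x, (x 0, x (-1)) = z ∧ IsHenonOrbit c b x ∧
      (∀ n, (x n, x (n - 1)) ∈ henonJulia c b) ∧ ∀ n, ‖x n‖ ≤ ‖c‖ + 3 := by
  obtain ⟨x, hx0, hx, hxJ⟩ := (invariant_henonJulia c hb0).exists_isHenonOrbit hb0 hz
  obtain ⟨⟨B, hB⟩, ⟨B', hB'⟩⟩ := henonJulia_subset hb0 hb hz
  refine ⟨x, hx0, hx, hxJ, hx.norm_le hb (B := max B B') fun n => ?_⟩
  rw [← hx0] at hB hB'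
  rcases n.eq_nat_or_neg with ⟨m, rfl | rfl⟩
  · refine le_trans ?_ (le_max_left _ _)
    have := hB m
    rw [hx.iterate_henon] at this
    exact (norm_fst_le _).trans this
  · refine le_trans ?_ (le_max_right _ _)
    have := hB' m
    rw [hx.iterate_henonInv hb0] at this
    exact (norm_fst_le _).trans this

/-! ### Growth of tangent vectors -/

lemma exists_tangent_bound {E : Type*} [NormedAddCommGroup E] [NormedSpace ℂ E] {f : E → E}
    {R : ℝ} (hf : Differentiable ℂ f) (ht : TrapsBounded f R) {p : E}
    (hp : p ∈ interior (Kset f)) {V : ℕ → E} (hV : ∀ n, V (n + 1) = fderiv ℂ f (f^[n] p) (V n)) :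
    ∃ B, ∀ n, ‖V n‖ ≤ B := by
  obtain ⟨ρ, hρ, M, hM⟩ := exists_uniform_bound_of_mem_interior ht hp
  have hpos : 0 < ‖V 0‖ + 1 := by positivity
  refine ⟨M / (ρ / (‖V 0‖ + 1)), fun n => ?_⟩
  have hder : ∀ n, HasDerivAt (fun t : ℂ => f^[n] (p + t • V 0)) (V n) 0 := fun n => by
    induction n with
    | zero => simpa using ((hasDerivAt_id (0 : ℂ)).smul_const (V 0)).const_add p
    | succ n ih =>
      have h := (hf (f^[n] (p + (0 : ℂ) • V 0))).hasFDerivAt.comp_hasDerivAt 0 ih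
      rw [zero_smul, add_zero, ← hV] at h
      simp only [Function.iterate_succ_apply']
      exact h
  refine norm_hasDerivAt_le (by have := hf.iterate n; fun_prop) (by positivity) (fun t ht => ?_)
    (hder n)
  refine hM _ ?_ n
  rw [sub_zero, le_div_iff₀ hpos] at ht
  rw [add_sub_cancel_left, norm_smul]
  nlinarith [norm_nonneg t]

lemma hasFDerivAt_henon (c b : ℂ) (p : ℂ × ℂ) : HasFDerivAt (henon c b)
    (((2 * p.1) • ContinuousLinearMap.fst ℂ ℂ ℂ - b • ContinuousLinearMap.snd ℂ ℂ ℂ).prod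
      (ContinuousLinearMap.fst ℂ ℂ ℂ)) p := by
  refine HasFDerivAt.prodMk ?_ hasFDerivAt_fst
  have h := (((hasFDerivAt_fst (𝕜 := ℂ) (p := p)).pow 2).add_const c).sub
    ((hasFDerivAt_snd (𝕜 := ℂ) (p := p)).const_mul b)
  exact h.congr_fderiv (by simp)

lemma hasFDerivAt_henonInv (c b : ℂ) (p : ℂ × ℂ) : HasFDerivAt (henonInv c b)
    ((ContinuousLinearMap.snd ℂ ℂ ℂ).prod (b⁻¹ • ((2 * p.2) • ContinuousLinearMap.snd ℂ ℂ ℂ -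
      ContinuousLinearMap.fst ℂ ℂ ℂ))) p := by
  refine HasFDerivAt.prodMk hasFDerivAt_snd ?_
  have h := ((((hasFDerivAt_snd (𝕜 := ℂ) (p := p)).pow 2).add_const c).sub
    (hasFDerivAt_fst (𝕜 := ℂ) (p := p))).mul_const b⁻¹
  simpa [div_eq_mul_inv] using h

lemma fderiv_henon (c b : ℂ) (p v : ℂ × ℂ) :
    fderiv ℂ (henon c b) p v = (2 * p.1 * v.1 - b * v.2, v.1) := by
  rw [(hasFDerivAt_henon c b p).fderiv]; simp

lemma fderiv_henonInv (c b : ℂ) (p v : ℂ × ℂ) :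
    fderiv ℂ (henonInv c b) p v = (v.2, (2 * p.2 * v.2 - v.1) / b) := by
  rw [(hasFDerivAt_henonInv c b p).fderiv]; simp [div_eq_inv_mul]

/-- The inverse of a dissipative Hénon map expands volume. -/
lemma interior_Kset_henonInv {c b : ℂ} (hb0 : b ≠ 0) (hb : ‖b‖ < 1) :
    interior (Kset (henonInv c b)) = ∅ := by
  rw [eq_empty_iff_forall_notMem]
  intro p hp
  let T : ℂ × ℂ → ℕ → ℂ × ℂ := fun v n =>
    Nat.rec v (fun n v => fderiv ℂ (henonInv c b) ((henonInv c b)^[n] p) v) n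
  have hT : ∀ v n, T v (n + 1) = fderiv ℂ (henonInv c b) ((henonInv c b)^[n] p) (T v n) :=
    fun _ _ => rfl
  have hdiff : Differentiable ℂ (henonInv c b) := fun p =>
    (hasFDerivAt_henonInv c b p).differentiableAt
  obtain ⟨B, hB⟩ := exists_tangent_bound hdiff (trapsBounded_henonInv hb0 hb.le) hp (hT (1, 0))
  obtain ⟨B', hB'⟩ := exists_tangent_bound hdiff (trapsBounded_henonInv hb0 hb.le) hp (hT (0, 1))
  have hdet : ∀ n, (T (1, 0) n).1 * (T (0, 1) n).2 - (T (1, 0) n).2 * (T (0, 1) n).1 =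
      b⁻¹ ^ n := fun n => by
    induction n with
    | zero => simp [T]
    | succ n ih =>
      rw [pow_succ, ← ih, hT, hT, fderiv_henonInv, fderiv_henonInv]
      ring
  have hlam : 1 < ‖b⁻¹‖ := by
    rw [norm_inv]; exact (one_lt_inv₀ (norm_pos_iff.2 hb0)).2 hb
  obtain ⟨n, -, hn⟩ := not_forall_pow_le (M := B * B' + B * B') hlam one_pos
  rw [one_mul, ← norm_pow, ← hdet] at hn
  refine hn.not_ge ((norm_sub_le _ _).trans ?_)
  rw [norm_mul, norm_mul]
  have hBpos : 0 ≤ B := (norm_nonneg _).trans (hB 0)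
  gcongr
  exacts [(norm_fst_le _).trans (hB n), (norm_snd_le _).trans (hB' n),
    (norm_snd_le _).trans (hB n), (norm_fst_le _).trans (hB' n)]

lemma IsAdapted.notMem_interior_Kset_henon {c : ℂ} {Λ : Set ℂ} {φ : ℂ → ℝ} {μ Φ η : ℝ}
    (H : IsAdapted c Λ φ μ Φ η) {b : ℂ} (hb1 : ‖b‖ ≤ 1) (hb : 1 + Φ * ‖b‖ < μ)
    {v x : ℤ → ℂ} (hv : IsOrbitIn c Λ v) (hx : IsHenonOrbit c b x) (h : ∀ n, ‖x n - v n‖ ≤ η) :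
    (x 0, x (-1)) ∉ interior (Kset (henon c b)) := by
  intro hp
  let V : ℕ → ℂ × ℂ := fun n => Nat.rec (1, 0)
    (fun n v => fderiv ℂ (henon c b) ((henon c b)^[n] (x 0, x (-1))) v) n
  have hV : ∀ n, V (n + 1) = fderiv ℂ (henon c b) ((henon c b)^[n] (x 0, x (-1))) (V n) :=
    fun _ => rfl
  obtain ⟨B, hB⟩ := exists_tangent_bound
    (fun p => (hasFDerivAt_henon c b p).differentiableAt) (trapsBounded_henon hb1) hp hV
  have hΦ := H.one_le_bound
  have hgrow : ∀ n : ℕ, (μ - Φ * ‖b‖) ^ n ≤ φ (v n) * ‖(V n).1‖ ∧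
      ‖(V n).2‖ ≤ φ (v n) * ‖(V n).1‖ := fun n => by
    induction n with
    | zero => simpa [V] using ⟨H.one_le _ (hv 0).1, zero_le_one.trans (H.one_le _ (hv 0).1)⟩
    | succ n ih =>
      have hstep : (μ - Φ * ‖b‖) * (φ (v n) * ‖(V n).1‖) ≤
          φ (v (n + 1)) * ‖(V (n + 1)).1‖ := by
        have h1 := H.expand _ (hv n).1 _ _ (h n) (h n)
        rw [(hv n).2, ← two_mul] at h1
        have h2 : ‖2 * x n‖ * ‖(V n).1‖ - ‖b‖ * ‖(V n).2‖ ≤ ‖(V (n + 1)).1‖ := by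
          rw [hV, fderiv_henon, hx.iterate_henon, ← norm_mul, ← norm_mul]
          exact norm_sub_norm_le _ _
        have hpos : 0 ≤ φ (v (n + 1)) := zero_le_one.trans (H.one_le _ (hv _).1)
        have h3 := mul_le_mul_of_nonneg_left h2 hpos
        have h4 := mul_le_mul_of_nonneg_right h1 (norm_nonneg (V n).1)
        have h5 : φ (v (n + 1)) * (‖b‖ * ‖(V n).2‖) ≤ Φ * (‖b‖ * (φ (v n) * ‖(V n).1‖)) := by
          have := H.le _ (hv (n + 1)).1
          have := ih.2
          gcongr
        linarith
      have hge : φ (v n) * ‖(V n).1‖ ≤ (μ - Φ * ‖b‖) * (φ (v n) * ‖(V n).1‖) :=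
        le_mul_of_one_le_left ((norm_nonneg _).trans ih.2) (by linarith)
      push_cast
      refine ⟨?_, ?_⟩
      · rw [pow_succ']
        refine le_trans ?_ hstep
        have := ih.1
        have : 0 ≤ μ - Φ * ‖b‖ := by linarith
        gcongr
      · refine le_trans ?_ (hge.trans hstep)
        rw [hV, fderiv_henon]
        exact H.le_weight_mul (hv n).1 (norm_nonneg _)
  obtain ⟨n, -, hn⟩ := not_forall_pow_le (M := Φ * B) (by linarith : 1 < μ - Φ * ‖b‖) one_pos
  rw [one_mul] at hn
  have h1 := (hgrow n).1.trans (H.weight_mul_le (hv n).1 (norm_nonneg _))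
  have h2 : Φ * ‖(V n).1‖ ≤ Φ * B := by
    gcongr
    exact (norm_fst_le _).trans (hB n)
  linarith

/-! ### Localization of the Julia set -/

lemma continuous_iterate_henon (c : ℂ) (n : ℕ) :
    Continuous fun s : ℂ × (ℂ × ℂ) => (henon c s.1)^[n] s.2 := by
  induction n with
  | zero => exact continuous_snd
  | succ n ih =>
    simp only [Function.iterate_succ_apply']
    simp only [henon] at ih ⊢
    fun_prop

lemma iterate_henon_zero_fst (c : ℂ) (p : ℂ × ℂ) (n : ℕ) :
    ((henon c 0)^[n] p).1 = (qmap c)^[n] p.1 := by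
  induction n with
  | zero => rfl
  | succ n ih =>
    rw [Function.iterate_succ_apply', Function.iterate_succ_apply', ← ih]
    simp [henon, qmap]

lemma isOpen_weighted_near (Λ : Set ℂ) (φ : ℂ → ℝ) (s : ℝ) :
    IsOpen {x | ∃ w ∈ Λ, φ w * ‖x - w‖ < s} := by
  have : {x | ∃ w ∈ Λ, φ w * ‖x - w‖ < s} = ⋃ w ∈ Λ, {x | φ w * ‖x - w‖ < s} := by
    ext; simp
  rw [this]
  exact isOpen_biUnion fun w _ => isOpen_lt (by fun_prop) continuous_const

section Localization

variable {c : ℂ} {Λ : Set ℂ} {φ : ℂ → ℝ} {μ Φ η : ℝ}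

/-- For small `b`, points of bounded orbit of `q` that are not near its Julia set are interior
to the set of points of bounded `H_b`-orbit. -/
lemma IsAdapted.exists_near_of_fst_mem_Kset (H : IsAdapted c Λ φ μ Φ η)
    (hinv : Invariant (qmap c) Λ) (hJ : Λ = Jset (qmap c)) {r : ℝ} (hr0 : 0 < r)
    (hr : r ≤ η ^ 2) {b : ℂ} (hb : Φ * (‖b‖ * (‖c‖ + 4)) ≤ r - r / μ) {z : ℂ × ℂ}
    (hz : z ∈ Jset (henon c b)) (hz1 : z.1 ∈ Kset (qmap c)) (hz2 : ‖z.2‖ ≤ ‖c‖ + 3) :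
    ∃ w ∈ Λ, φ w * ‖z.1 - w‖ < r := by
  by_contra hno
  have hμ := H.one_lt
  have hΦ : 0 < Φ := one_pos.trans_le H.one_le_bound
  have hμ0 : 0 < μ := by linarith
  have hgap : 0 < r - r / μ := sub_pos.2 (div_lt_self hr0 hμ)
  have pert : ∀ x ∈ Kset (qmap c), (¬ ∃ w ∈ Λ, φ w * ‖x - w‖ < r) → ∀ y,
      Φ * ‖y - x‖ ≤ r - r / μ → y ∈ Kset (qmap c) ∧ ¬ ∃ w ∈ Λ, φ w * ‖y - w‖ < r / μ := by
    intro x hxK hx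
    have hfar : ∀ y, Φ * ‖y - x‖ ≤ r - r / μ → ¬ ∃ w ∈ Λ, φ w * ‖y - w‖ < r / μ := by
      rintro y hy ⟨w, hw, hlt⟩
      refine hx ⟨w, hw, ?_⟩
      have h1 := norm_sub_le_norm_sub_add_norm_sub x y w
      rw [norm_sub_rev x y] at h1
      have h2 := H.weight_mul_le hw (norm_nonneg (y - x))
      have h3 := mul_le_mul_of_nonneg_left h1 (zero_le_one.trans (H.one_le w hw))
      linarith
    refine fun y hy => ⟨?_, hfar y hy⟩
    by_contra hyK
    have hmem : ∀ u, u ∈ closedBall x ((r - r / μ) / Φ) ↔ Φ * ‖u - x‖ ≤ r - r / μ := fun u => by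
      rw [mem_closedBall_iff_norm, le_div_iff₀' hΦ]
    have hint : ∀ u ∈ closedBall x ((r - r / μ) / Φ), u ∈ Kset (qmap c) →
        u ∈ interior (Kset (qmap c)) := fun u hu huK => by
      by_contra hui
      exact hfar u ((hmem u).1 hu)
        ⟨u, by rw [hJ]; exact ⟨subset_closure huK, hui⟩, by simpa using div_pos hr0 hμ0⟩
    have hxB : x ∈ closedBall x ((r - r / μ) / Φ) := mem_closedBall_self (by positivity)
    obtain ⟨u, -, hu, hu'⟩ := (convex_closedBall x ((r - r / μ) / Φ)).isPreconnected _ _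
      isOpen_interior (isClosed_Kset_qmap c).isOpen_compl
      (fun u hu => (em (u ∈ Kset (qmap c))).imp_left (hint u hu))
      ⟨x, hxB, hint x hxB hxK⟩ ⟨y, (hmem y).2 hy, hyK⟩
    exact hu' (interior_subset hu)
  refine hz.2 (mem_interior_iff_mem_nhds.2 ?_)
  have hδ : 0 < min ((r - r / μ) / Φ) 1 := by positivity
  filter_upwards [closedBall_mem_nhds z hδ] with z' hz'
  rw [mem_closedBall_iff_norm] at hz'
  have h1 : ‖z'.1 - z.1‖ ≤ (r - r / μ) / Φ :=
    (norm_fst_le (z' - z)).trans (hz'.trans (min_le_left _ _))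
  have h2 : ‖z'.2 - z.2‖ ≤ 1 := (norm_snd_le (z' - z)).trans (hz'.trans (min_le_right _ _))
  have hstay : ∀ n : ℕ, (((henon c b)^[n] z').1 ∈ Kset (qmap c) ∧
      ¬ ∃ w ∈ Λ, φ w * ‖((henon c b)^[n] z').1 - w‖ < r / μ) ∧
      ‖((henon c b)^[n] z').2‖ ≤ ‖c‖ + 4 := fun n => by
    induction n with
    | zero =>
      refine ⟨pert z.1 hz1 hno _ (by rwa [le_div_iff₀' hΦ] at h1), ?_⟩
      have := norm_add_le (z'.2 - z.2) z.2
      rw [sub_add_cancel] at this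
      change ‖z'.2‖ ≤ _
      linarith
    | succ n ih =>
      obtain ⟨⟨hK, hfar⟩, hle⟩ := ih
      rw [Function.iterate_succ_apply']
      set p := (henon c b)^[n] z'
      refine ⟨pert (qmap c p.1) (image_mem_Kset_iff.2 hK) ?_ _ ?_, ?_⟩
      · rintro ⟨w, hw, hlt⟩
        obtain ⟨w', hw', -, hlt'⟩ := H.pullback hinv hw (hlt.le.trans hr)
        exact hfar ⟨w', hw', by rw [lt_div_iff₀' hμ0]; exact hlt'.trans_lt hlt⟩
      · refine le_trans ?_ hb
        have e : (henon c b p).1 - qmap c p.1 = -(b * p.2) := by simp only [henon, qmap]; ring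
        rw [e, norm_neg, norm_mul]
        gcongr
      · have := norm_le_of_mem_Kset_qmap hK
        change ‖p.1‖ ≤ _
        linarith
  refine ⟨‖c‖ + 4, fun n => max_le ?_ (hstay n).2⟩
  have := norm_le_of_mem_Kset_qmap (hstay n).1.1
  linarith

lemma IsAdapted.exists_near_of_mem_henonJulia (H : IsAdapted c Λ φ μ Φ η)
    (hinv : Invariant (qmap c) Λ) (hJ : Λ = Jset (qmap c)) {r : ℝ} (hr0 : 0 < r)
    (hr : r ≤ η ^ 2) : ∃ ε > 0, ∀ b : ℂ, b ≠ 0 → ‖b‖ < ε → ∀ z ∈ henonJulia c b,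
      ∃ w ∈ Λ, φ w * ‖z.1 - w‖ < r := by
  have hμ := H.one_lt
  have hΦ : 0 < Φ := one_pos.trans_le H.one_le_bound
  have hgap : 0 < r - r / μ := sub_pos.2 (div_lt_self hr0 hμ)
  set C := closedBall (0 : ℂ) (‖c‖ + 3) \ (interior (Kset (qmap c)) ∪
    {x | ∃ w ∈ Λ, φ w * ‖x - w‖ < r})
  have hC : IsCompact C :=
    (isCompact_closedBall _ _).diff (isOpen_interior.union (isOpen_weighted_near Λ φ r))
  have hCK : ∀ x ∈ C, x ∉ Kset (qmap c) := fun x hx hxK => hx.2 <| by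
    by_cases hi : x ∈ interior (Kset (qmap c))
    · exact Or.inl hi
    · exact Or.inr ⟨x, by rw [hJ]; exact ⟨subset_closure hxK, hi⟩, by simpa using hr0⟩
  set W : Set (ℂ × (ℂ × ℂ)) := ⋃ n : ℕ, {s | ‖c‖ + 3 < ‖((henon c s.1)^[n] s.2).1‖}
  have hW : IsOpen W := isOpen_iUnion fun n =>
    isOpen_lt continuous_const (continuous_iterate_henon c n).fst.norm
  obtain ⟨u, v, hu, -, h0u, hCv, huv⟩ := generalized_tube_lemma (isCompact_singleton (x := (0 : ℂ)))
    (hC.prod (isCompact_closedBall (0 : ℂ) (‖c‖ + 3))) hW (by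
      rintro ⟨b, x, y⟩ ⟨hb, hx, -⟩
      have hb : b = 0 := hb
      subst hb
      by_contra hno
      refine hCK x hx ⟨‖c‖ + 3, fun n => ?_⟩
      rw [← iterate_henon_zero_fst c (x, y)]
      exact not_lt.1 fun hlt => hno (mem_iUnion.2 ⟨n, hlt⟩))
  obtain ⟨ε, hε, hεu⟩ := Metric.isOpen_iff.1 hu 0 (h0u rfl)
  refine ⟨min (min ε 1) ((r - r / μ) / (Φ * (‖c‖ + 4))), by positivity, fun b hb0 hb z hz => ?_⟩
  rw [lt_min_iff, lt_min_iff, lt_div_iff₀ (by positivity)] at hb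
  obtain ⟨⟨hbε, hb1⟩, hbr⟩ := hb
  obtain ⟨x, rfl, hx, -, hxR⟩ := exists_isHenonOrbit_of_mem_henonJulia hb0 hb1.le hz
  by_contra hno
  by_cases hxK : x 0 ∈ Kset (qmap c)
  · exact hno (H.exists_near_of_fst_mem_Kset hinv hJ hr0 hr (by linarith) hz.1 hxK (hxR _))
  · have hxC : x 0 ∈ C := ⟨mem_closedBall_zero_iff.2 (hxR 0), by
      rintro (h | h)
      exacts [hxK (interior_subset h), hno h]⟩
    have := huv (mk_mem_prod (hεu (mem_ball_zero_iff.2 hbε))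
      (hCv (mk_mem_prod hxC (mem_closedBall_zero_iff.2 (hxR (-1))))))
    obtain ⟨n, hn⟩ := mem_iUnion.1 this
    have hn : ‖c‖ + 3 < ‖((henon c b)^[n] (x 0, x (-1))).1‖ := hn
    rw [hx.iterate_henon] at hn
    exact (hxR n).not_gt hn

end Localization

/-! ### Coding of the hyperbolic sets by orbits of `q` -/

lemma gmap_comp_mem_SigmaSet {c : ℂ} {Λ : Set ℂ} {w : ℤ → ℂ} (hw : IsOrbitIn c Λ w) :
    (fun i => gmap c (w i)) ∈ SigmaSet (henon c 0) (gmap c '' Λ) := by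
  refine ⟨fun i => mem_image_of_mem _ (hw i).1, fun i => ?_⟩
  change henon c 0 (qmap c (w i), w i) = (qmap c (w (i + 1)), w (i + 1))
  rw [← (hw i).2]
  simp [henon, qmap]

lemma exists_coding {c b : ℂ} {Λ : Set ℂ} {S : Set (ℂ × ℂ)}
    (h : SigmaSet (henon c 0) (gmap c '' Λ) ≃ₜ S)
    (hconj : ∀ z, (h (sigmaShift (henon c 0) (gmap c '' Λ) z) : ℂ × ℂ) = henon c b (h z)) :
    ∃ X : {w // IsOrbitIn c Λ w} → ℤ → ℂ, Function.Injective X ∧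
      (∀ w, IsHenonOrbit c b (X w) ∧ ∀ n, (X w n, X w (n - 1)) ∈ S) ∧
      ∀ w (p : ℤ), Function.Periodic w.1 p → Function.Periodic (X w) p := by
  let Z : {w // IsOrbitIn c Λ w} → ℤ → SigmaSet (henon c 0) (gmap c '' Λ) :=
    fun w n => ⟨_, gmap_comp_mem_SigmaSet (w.2.shift n)⟩
  have hZ : ∀ w n, sigmaShift (henon c 0) (gmap c '' Λ) (Z w n) = Z w (n + 1) := fun w n => by
    ext1
    funext i
    change gmap c (w.1 (i + 1 + n)) = gmap c (w.1 (i + (n + 1)))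
    rw [add_assoc, add_comm 1 n]
  have hP : ∀ w n, (h (Z w (n + 1)) : ℂ × ℂ) = henon c b (h (Z w n)) := fun w n => by
    rw [← hZ, hconj]
  have horb := fun w => isHenonOrbit_fst (P := fun n => (h (Z w n) : ℂ × ℂ)) (hP w)
  refine ⟨fun w n => (h (Z w n) : ℂ × ℂ).1, fun w w' hww' => ?_, fun w => ?_, fun w p hp n => ?_⟩
  · have h0 : (h (Z w 0) : ℂ × ℂ) = h (Z w' 0) := by
      rw [← (horb w).2 0, ← (horb w').2 0]
      exact congrArg₂ Prod.mk (congrFun hww' 0) (congrFun hww' _)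
    have h1 := congrArg Subtype.val (h.injective (Subtype.ext h0))
    ext i
    have h2 : gmap c (w.1 (i + 0)) = gmap c (w'.1 (i + 0)) := congrFun h1 i
    rw [add_zero] at h2
    exact congrArg Prod.snd h2
  · refine ⟨(horb w).1, fun n => mem_of_eq_of_mem ((horb w).2 n) (h (Z w n)).2⟩
  · have : Z w (n + p) = Z w n := by
      ext1
      funext i
      change gmap c (w.1 (i + (n + p))) = gmap c (w.1 (i + n))
      rw [← add_assoc, hp]
    simp only [this]

/-! ### Comparison with the Julia set -/

section Comparison

variable {c : ℂ} {Λ : Set ℂ} {φ : ℂ → ℝ} {μ Φ η : ℝ}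

lemma IsAdapted.exists_shadow_henon (H : IsAdapted c Λ φ μ Φ η) (hcomp : IsCompact Λ)
    (hinv : Invariant (qmap c) Λ) {r : ℝ} (hr : μ * r ≤ η ^ 2) {b : ℂ}
    (hbr : Φ * (‖b‖ * (‖c‖ + 3)) ≤ (μ - 1) * r) {x : ℤ → ℂ} (hx : IsHenonOrbit c b x)
    (hxR : ∀ n, ‖x n‖ ≤ ‖c‖ + 3) (hnear : ∀ n, ∃ w ∈ Λ, φ w * ‖x n - w‖ ≤ r) :
    ∃ v, IsOrbitIn c Λ v ∧ ∀ n, ‖x n - v n‖ ≤ r := by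
  refine H.exists_shadow hcomp hinv hr hbr (fun n => ?_) hnear
  rw [hx n, sub_sub_cancel_left, norm_neg, norm_mul]
  gcongr
  exact hxR _

lemma IsAdapted.subset_henonJulia (H : IsAdapted c Λ φ μ Φ η) (hcomp : IsCompact Λ)
    (hinv : Invariant (qmap c) Λ) {r : ℝ} (hr : μ * r ≤ η ^ 2) (hrη : r ≤ η) {b : ℂ}
    (hb0 : b ≠ 0) (hb1 : ‖b‖ < 1) (hbμ : 1 + Φ * ‖b‖ < μ)
    (hbr : Φ * (‖b‖ * (‖c‖ + 3)) ≤ (μ - 1) * r) {S : Set (ℂ × ℂ)} (hS : IsCompact S)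
    (hSinv : Invariant (henon c b) S) (hnear : ∀ z ∈ S, ∃ w ∈ Λ, φ w * ‖z.1 - w‖ ≤ r) :
    S ⊆ henonJulia c b := by
  intro z hz
  obtain ⟨x, rfl, hx, hxS⟩ := hSinv.exists_isHenonOrbit hb0 hz
  obtain ⟨B, hB⟩ := hS.isBounded.exists_norm_le
  have hB' : ∀ n, ‖x n‖ ≤ B := fun n => (norm_fst_le _).trans (hB _ (hxS n))
  obtain ⟨v, hv, hxv⟩ := H.exists_shadow_henon hcomp hinv hr hbr hx (hx.norm_le hb1.le hB')
    fun n => hnear _ (hxS n)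
  refine ⟨⟨subset_closure ⟨B, fun n => ?_⟩,
    H.notMem_interior_Kset_henon hb1.le hbμ hv hx fun n => (hxv n).trans hrη⟩,
    subset_closure ⟨B, fun n => ?_⟩, ?_⟩
  · rw [hx.iterate_henon]; exact hB _ (hxS _)
  · rw [hx.iterate_henonInv hb0]; exact hB _ (hxS _)
  · rw [interior_Kset_henonInv hb0 hb1]; exact notMem_empty _

/-- Every periodic orbit of `q` in `Λ` is shadowed by a coded orbit: shadowing is an injection
between the finite sets of periodic orbits of a given period. -/
lemma IsAdapted.exists_coded_near_periodic (H : IsAdapted c Λ φ μ Φ η) {r : ℝ}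
    (hr0 : 0 < r) (h2r : 2 * r ≤ η) {b : ℂ} (hbμ : 1 + Φ * ‖b‖ < μ)
    {X : {w // IsOrbitIn c Λ w} → ℤ → ℂ} (hXinj : Function.Injective X)
    (hX : ∀ w, IsHenonOrbit c b (X w))
    (hXper : ∀ w (p : ℤ), Function.Periodic w.1 p → Function.Periodic (X w) p)
    (hshadow : ∀ w, ∃ v, IsOrbitIn c Λ v ∧ ∀ n, ‖X w n - v n‖ ≤ r) {p : ℕ} (hp : 0 < p)
    {u : ℤ → ℂ} (hu : IsOrbitIn c Λ u) (hup : Function.Periodic u (p : ℤ)) :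
    ∃ w, ∀ n, ‖X w n - u n‖ ≤ r := by
  choose s hsO hs using hshadow
  have hper : ∀ w, Function.Periodic w.1 (p : ℤ) → Function.Periodic (s w) (p : ℤ) :=
    fun w hw n => by
      refine congrFun (H.shadow_unique h2r ((hsO w).shift p) (hsO w) (x := X w) (fun n => ?_)
        (hs w)) n
      rw [← hXper w p hw n]
      exact hs w _
  have hsinj : Function.Injective s := fun w w' h => hXinj <|
    H.orbit_unique hbμ (hsO w) (hX w) (hX w') (fun n => (hs w n).trans (by linarith))
      (fun n => by rw [h]; exact (hs w' n).trans (by linarith))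
  let F := {w | IsOrbitIn c Λ w ∧ Function.Periodic w (p : ℤ)}
  have : Finite F := finite_periodic_orbits c Λ hp
  let f : F → F := fun w => ⟨s ⟨w.1, w.2.1⟩, hsO _, hper _ w.2.2⟩
  have hf : Function.Injective f := fun w w' h => by
    have := hsinj (congrArg Subtype.val h : s ⟨w.1, w.2.1⟩ = s ⟨w'.1, w'.2.1⟩)
    exact Subtype.ext (congrArg (fun w => w.1) this)
  obtain ⟨w, hw⟩ := Finite.injective_iff_surjective.1 hf ⟨u, hu, hup⟩
  have hwu : s ⟨w.1, w.2.1⟩ = u := congrArg Subtype.val hw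
  exact ⟨⟨w.1, w.2.1⟩, fun n => by rw [← hwu]; exact hs _ n⟩

lemma IsAdapted.henonJulia_subset (H : IsAdapted c Λ φ μ Φ η) (hcomp : IsCompact Λ)
    (hinv : Invariant (qmap c) Λ) (hexp : IsExpandingOn (qmap c) Λ) {r : ℝ} (hr0 : 0 < r)
    (hr : μ * r ≤ η ^ 2) (h2r : 2 * r ≤ η) {b : ℂ}
    (hb0 : b ≠ 0) (hb1 : ‖b‖ < 1) (hbμ : 1 + Φ * ‖b‖ < μ)
    (hbr : Φ * (‖b‖ * (‖c‖ + 3)) ≤ (μ - 1) * r)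
    (hnearJ : ∀ z ∈ henonJulia c b, ∃ w ∈ Λ, φ w * ‖z.1 - w‖ ≤ r) {S : Set (ℂ × ℂ)}
    (hS : IsCompact S) (hnear : ∀ z ∈ S, ∃ w ∈ Λ, φ w * ‖z.1 - w‖ ≤ r)
    {X : {w // IsOrbitIn c Λ w} → ℤ → ℂ} (hXinj : Function.Injective X)
    (hX : ∀ w, IsHenonOrbit c b (X w) ∧ ∀ n, (X w n, X w (n - 1)) ∈ S)
    (hXper : ∀ w (p : ℤ), Function.Periodic w.1 p → Function.Periodic (X w) p) :
    henonJulia c b ⊆ S := by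
  intro z hz
  obtain ⟨x, rfl, hx, hxJ, hxR⟩ := exists_isHenonOrbit_of_mem_henonJulia hb0 hb1.le hz
  obtain ⟨v, hv, hxv⟩ := H.exists_shadow_henon hcomp hinv hr hbr hx hxR fun n => hnearJ _ (hxJ n)
  obtain ⟨B, hB⟩ := hS.isBounded.exists_norm_le
  have hshadow : ∀ w, ∃ v, IsOrbitIn c Λ v ∧ ∀ n, ‖X w n - v n‖ ≤ r := fun w =>
    H.exists_shadow_henon hcomp hinv hr hbr (hX w).1
      ((hX w).1.norm_le hb1.le fun n => (norm_fst_le _).trans (hB _ ((hX w).2 n)))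
      fun n => hnear _ ((hX w).2 n)
  let D : ℕ → Set (ℤ → ℂ) := fun M => {a | IsHenonOrbit c b a ∧ (∀ n, (a n, a (n - 1)) ∈ S) ∧
    ∀ n : ℤ, |n| ≤ M → ‖a n - v n‖ ≤ 2 * r}
  have hclosed : ∀ M, IsClosed (D M) := fun M => by
    simp only [D, IsHenonOrbit, ofPred_and, ofPred_forall]
    refine IsClosed.inter (isClosed_iInter fun n => isClosed_eq (by fun_prop) ?_)
      (IsClosed.inter (isClosed_iInter fun n => hS.isClosed.preimage (by fun_prop))
        (isClosed_iInter fun n => isClosed_iInter fun _ => isClosed_le (by fun_prop)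
          continuous_const))
    exact ((continuous_qmap c).comp (continuous_apply n)).sub (by fun_prop)
  have hcompact : IsCompact (D 0) :=
    (isCompact_univ_pi fun _ : ℤ => hS.image continuous_fst).of_isClosed_subset (hclosed 0)
      fun a ha n _ => ⟨_, ha.2.1 n, rfl⟩
  have hnonempty : ∀ M, (D M).Nonempty := fun M => by
    obtain ⟨p, hp, u, hu, hup, hvu⟩ := H.exists_periodic_near hcomp hinv hexp hr0 hr h2r
      (hv.shift (-M)) (2 * M)
    obtain ⟨w, hw⟩ := H.exists_coded_near_periodic hr0 h2r hbμ hXinj (fun w => (hX w).1) hXper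
      hshadow hp (hu.shift M) (fun n => by
        rw [add_right_comm, hup])
    refine ⟨X w, (hX w).1, (hX w).2, fun n hn => ?_⟩
    rw [abs_le] at hn
    have h1 := hvu (n + M).toNat (by omega)
    rw [Int.toNat_of_nonneg (by linarith), add_neg_cancel_right, norm_sub_rev] at h1
    have h2 := norm_sub_le_norm_sub_add_norm_sub (X w n) (u (n + M)) (v n)
    linarith [hw n]
  obtain ⟨a, ha⟩ := IsCompact.nonempty_iInter_of_sequence_nonempty_isCompact_isClosed D
    (fun M a ha => ⟨ha.1, ha.2.1, fun n hn => ha.2.2 n (by push_cast; omega)⟩)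
    hnonempty hcompact hclosed
  rw [mem_iInter] at ha
  have hax : a = x := H.orbit_unique hbμ hv (ha 0).1 hx
    (fun n => ((ha n.natAbs).2.2 n (by simp)).trans h2r) (fun n => (hxv n).trans (by linarith))
  rw [← hax]
  exact (ha 0).2.1 0

end Comparison

/-! ### Nonemptiness of the Julia set -/

lemma henonJulia_nonempty {c : ℂ} {b : ℝ} (hb0 : 0 < b) (hb1 : b < 1)
    (hD : (1 + b : ℂ) ^ 2 ≠ 4 * c) : (henonJulia c b).Nonempty := by
  have hbn : ‖(b : ℂ)‖ = b := by rw [Complex.norm_real, Real.norm_of_nonneg hb0.le]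
  have hbC : (b : ℂ) ≠ 0 := by exact_mod_cast hb0.ne'
  obtain ⟨s, hs, hre⟩ : ∃ s : ℂ, s ^ 2 = (1 + b) ^ 2 - 4 * c ∧ 0 ≤ s.re := by
    obtain ⟨s, hs⟩ := IsAlgClosed.exists_pow_nat_eq ((1 + b : ℂ) ^ 2 - 4 * c) two_pos
    rcases le_total 0 s.re with h | h
    · exact ⟨s, hs, h⟩
    · exact ⟨-s, by rw [neg_sq, hs], by simpa using h⟩
  have hs0 : s ≠ 0 := by
    rintro rfl
    exact hD (by linear_combination -hs)
  set x := (1 + b + s) / 2 with hx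
  have hfix : henon c b (x, x) = (x, x) := by
    simp only [henon, Prod.mk.injEq, and_true]
    rw [hx]; linear_combination hs / 4
  have hfix' : henonInv c b (x, x) = (x, x) := by
    conv_lhs => rw [← hfix]
    exact henonInv_henon hbC _
  have h2x : 1 + b < ‖2 * x‖ := by
    have e : 2 * x = ((1 + b : ℝ) : ℂ) + s := by rw [hx]; push_cast; ring
    refine lt_of_pow_lt_pow_left₀ 2 (norm_nonneg _) ?_
    have h1 := Complex.normSq_pos.2 hs0
    rw [e, ← Complex.normSq_eq_norm_sq]
    simp only [Complex.normSq_apply, Complex.add_re, Complex.add_im, Complex.ofReal_re,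
      Complex.ofReal_im] at h1 ⊢
    nlinarith [mul_nonneg hre hb0.le]
  obtain ⟨t, ht, htroot⟩ : ∃ t : ℂ, 1 < ‖t‖ ∧ 2 * x * t - b = t ^ 2 := by
    obtain ⟨d, hd⟩ := IsAlgClosed.exists_pow_nat_eq (x ^ 2 - b) two_pos
    by_contra! hno
    have h1 : ‖x + d‖ ≤ 1 := not_lt.1 fun h => hno _ h (by linear_combination -hd)
    have h2 : ‖x - d‖ ≤ 1 := not_lt.1 fun h => hno _ h (by linear_combination -hd)
    have h3 : ‖x + d‖ * ‖x - d‖ = b := by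
      rw [← norm_mul, ← hbn]
      congr 1
      linear_combination -hd
    have h4 := norm_add_le (x + d) (x - d)
    rw [show x + d + (x - d) = 2 * x by ring] at h4
    nlinarith
  have hK : (x, x) ∉ interior (Kset (henon c b)) := by
    intro hp
    obtain ⟨B, hB⟩ := exists_tangent_bound
      (fun p => (hasFDerivAt_henon c b p).differentiableAt)
      (trapsBounded_henon (hbn.trans_le hb1.le)) hp (V := fun n => (t ^ (n + 1), t ^ n))
      (fun n => by
        rw [Function.iterate_fixed hfix, fderiv_henon]
        ext
        · linear_combination -t ^ n * htroot
        · rfl)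
    obtain ⟨n, -, hn⟩ := not_forall_pow_le (M := B) ht one_pos
    rw [one_mul, ← norm_pow] at hn
    exact hn.not_ge ((norm_snd_le _).trans (hB n))
  refine ⟨(x, x), ⟨subset_closure ⟨‖(x, x)‖, fun n => ?_⟩, hK⟩,
    subset_closure ⟨‖(x, x)‖, fun n => ?_⟩, ?_⟩
  · rw [Function.iterate_fixed hfix]
  · rw [Function.iterate_fixed hfix']
  · rw [interior_Kset_henonInv hbC (hbn.trans_lt hb1)]; exact notMem_empty _

lemma exists_henonJulia_nonempty (c : ℂ) {ε : ℝ} (hε : 0 < ε) :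
    ∃ b : ℂ, b ≠ 0 ∧ ‖b‖ < ε ∧ (henonJulia c b).Nonempty := by
  obtain ⟨b, hb0, hb1, hbε, hD⟩ : ∃ b : ℝ, 0 < b ∧ b < 1 ∧ b < ε ∧ (1 + b : ℂ) ^ 2 ≠ 4 * c := by
    set m := min ε 1 with hm
    have hm0 : 0 < m := lt_min hε one_pos
    have hmε : m ≤ ε := min_le_left _ _
    have hm1 : m ≤ 1 := min_le_right _ _
    by_cases h : (1 + (m / 2 : ℝ) : ℂ) ^ 2 = 4 * c
    · refine ⟨m / 3, by linarith, by linarith, by linarith, fun h' => ?_⟩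
      have h'' := h.trans h'.symm
      norm_cast at h''
      nlinarith
    · exact ⟨m / 2, by linarith, by linarith, by linarith, h⟩
  exact ⟨b, by exact_mod_cast hb0.ne', by rwa [Complex.norm_real, Real.norm_of_nonneg hb0.le],
    henonJulia_nonempty hb0 hb1 hD⟩

/-- Under the conclusion of the main conjugacy theorem (with `A_b → A` in Hausdorff
distance as `b → 0`): `A_b = J(H_b)` for all sufficiently small `b ≠ 0` if and only
if `Λ = J(q)`. -/
theorem Ab_eq_julia_iff (c : ℂ) (Λ : Set ℂ) (hcomp : IsCompact Λ)
    (hinv : Invariant (qmap c) Λ) (hexp : IsExpandingOn (qmap c) Λ)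
    (ε₀ : ℝ) (hε₀ : 0 < ε₀) (Ab : ℂ → Set (ℂ × ℂ))
    (hAb : ∀ b : ℂ, b ≠ 0 → ‖b‖ < ε₀ →
      IsCompact (Ab b) ∧ Invariant (henon c b) (Ab b) ∧
      IsHyperbolicSet (henon c b) (henonInv c b) (Ab b) ∧
      ∃ h : (SigmaSet (henon c 0) (gmap c '' Λ)) ≃ₜ (Ab b),
        ∀ z : SigmaSet (henon c 0) (gmap c '' Λ),
          (h (sigmaShift (henon c 0) (gmap c '' Λ) z) : ℂ × ℂ) = henon c b (h z))
    (hconv : Filter.Tendsto (fun b => Metric.hausdorffDist (Ab b) (gmap c '' Λ))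
      (nhdsWithin 0 {b : ℂ | b ≠ 0}) (nhds 0)) :
    (∃ ε : ℝ, 0 < ε ∧ ε ≤ ε₀ ∧ ∀ b : ℂ, b ≠ 0 → ‖b‖ < ε → Ab b = henonJulia c b) ↔
      Λ = Jset (qmap c) := by
  constructor
  · rintro ⟨ε, hε, hεε₀, hJ⟩
    rcases Λ.eq_empty_or_nonempty with rfl | hne
    · obtain ⟨b, hb0, hbε, z, hz⟩ := exists_henonJulia_nonempty c hε
      rw [← hJ b hb0 hbε] at hz
      obtain ⟨-, -, -, h, -⟩ := hAb b hb0 (hbε.trans_le hεε₀)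
      obtain ⟨w, -⟩ := h.surjective ⟨z, hz⟩
      obtain ⟨y, hy, -⟩ := w.2.1 0
      exact hy.elim
    · exact (subset_Jset_of_isExpandingOn hcomp hinv hexp).antisymm
        (Jset_subset_of_isExpandingOn hcomp hinv hexp hne)
  · intro hΛ
    have hne : Λ.Nonempty := hΛ ▸ Jset_qmap_nonempty c
    obtain ⟨φ, μ, Φ, η, H⟩ := exists_isAdapted hcomp hinv hexp
    have hμ := H.one_lt
    have hμ' := sub_pos.2 hμ
    have hΦ : 0 < Φ := one_pos.trans_le H.one_le_bound
    have hη := H.pos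
    set r := min (η ^ 2 / μ) (η / 2)
    have hr0 : 0 < r := by positivity
    have hr : μ * r ≤ η ^ 2 := by
      rw [← le_div_iff₀' (by linarith)]; exact min_le_left _ _
    have h2r : 2 * r ≤ η := by linarith [min_le_right (η ^ 2 / μ) (η / 2)]
    obtain ⟨ε₁, hε₁, hnearJ⟩ :=
      H.exists_near_of_mem_henonJulia hinv hΛ hr0 ((le_mul_of_one_le_left hr0.le hμ.le).trans hr)
    obtain ⟨ε₂, hε₂, hdist⟩ := Metric.mem_nhdsWithin_iff.1
      (hconv.eventually_lt_const (by positivity : 0 < r / Φ))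
    refine ⟨min ε₀ (min (min ε₁ ε₂) (min 1 (min ((μ - 1) / Φ)
      ((μ - 1) * r / (Φ * (‖c‖ + 3)))))), by positivity, min_le_left _ _, fun b hb0 hb => ?_⟩
    simp only [lt_min_iff] at hb
    obtain ⟨hbε₀, ⟨hbε₁, hbε₂⟩, hb1, hbμ, hbr⟩ := hb
    rw [lt_div_iff₀ (by positivity)] at hbμ hbr
    have hbμ : 1 + Φ * ‖b‖ < μ := by linarith
    have hbr : Φ * (‖b‖ * (‖c‖ + 3)) ≤ (μ - 1) * r := by linarith
    obtain ⟨hS, hSinv, -, h, hconj⟩ := hAb b hb0 hbε₀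
    have hA : IsCompact (gmap c '' Λ) := hcomp.image ((continuous_qmap c).prodMk continuous_id)
    have hlt : hausdorffDist (Ab b) (gmap c '' Λ) < r / Φ :=
      hdist ⟨mem_ball_zero_iff.2 hbε₂, hb0⟩
    have hnear : ∀ z ∈ Ab b, ∃ w ∈ Λ, φ w * ‖z.1 - w‖ ≤ r := fun z hz => by
      obtain ⟨_, ⟨w, hw, rfl⟩, hwz⟩ := exists_dist_lt_of_hausdorffDist_lt hz hlt
        (hausdorffEDist_ne_top_of_nonempty_of_bounded ⟨z, hz⟩ (hne.image _)
          hS.isBounded hA.isBounded)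
      have hqw := hinv.apply_mem_iff.2 hw
      refine ⟨qmap c w, hqw, (H.weight_mul_le hqw (norm_nonneg _)).trans ?_⟩
      rw [← le_div_iff₀' hΦ]
      rw [dist_eq_norm] at hwz
      exact (norm_fst_le (z - gmap c w)).trans hwz.le
    obtain ⟨X, hXinj, hX, hXper⟩ := exists_coding h hconj
    refine (H.subset_henonJulia hcomp hinv hr (by linarith) hb0 hb1 hbμ hbr hS hSinv
      hnear).antisymm (H.henonJulia_subset hcomp hinv hexp hr0 hr h2r hb0 hb1 hbμ hbr
      (fun z hz => ?_) hS hnear hXinj hX hXper)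
    obtain ⟨w, hw, hlt⟩ := hnearJ b hb0 hbε₁ z hz
    exact ⟨w, hw, hlt.le⟩
end
end

section
/- Let k ≥ 2, let f : ℂ^k → ℂ^k be a diffeomorphism, and let S be a compact f-invariant set. Then S is uniformly hyperbolic if and only if there exists M > 0 such that for every z₀ ∈ S and every bounded sequence η = (η_i)_{i∈ℤ} in ℂ^k with ‖η‖_∞ = 1, the recurrence ξ_{i+1} − Df(f^i(z₀))·ξ_i = η_i for all i ∈ ℤ has a unique bounded solution ξ = (ξ_i)_{i∈ℤ}, and this solution satisfies ‖ξ‖_∞ ≤ M. -/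
noncomputable section
open Set Metric Topology Filter ENNReal

/-- `ℂ^k` with its standard Hermitian norm. -/
abbrev Ck (k : ℕ) := EuclideanSpace ℂ (Fin k)

/-- The full orbit `(z_i)_{i∈ℤ}` of `z0` under a diffeomorphism `f` with inverse `finv`:
`z_i = f^i(z₀)` for `i ≥ 0` and `z_i = finv^{|i|}(z₀)` for `i < 0`. -/
def orbitZ {E : Type*} (f finv : E → E) (z0 : E) : ℤ → E :=
  fun i => if 0 ≤ i then f^[i.toNat] z0 else finv^[(-i).toNat] z0
section Holomorphic

variable {E F : Type*} [NormedAddCommGroup E] [NormedSpace ℂ E] [FiniteDimensional ℂ E]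
  [NormedAddCommGroup F] [NormedSpace ℂ F]

/-- The derivative of a holomorphic map on a finite-dimensional space is continuous. -/
theorem Differentiable.continuous_fderiv_complex {g : E → F} (hg : Differentiable ℂ g) :
    Continuous (fderiv ℂ g) := by
  rw [continuous_clm_apply]
  intro v
  have hline (z : E) (t : ℂ) :
      HasDerivAt (fun t : ℂ => g (z + t • v)) (fderiv ℂ g (z + t • v) v) t := by
    have h1 : HasDerivAt (fun t : ℂ => z + t • v) v t := by
      simpa using ((hasDerivAt_id t).smul_const v).const_add z
    exact (hg (z + t • v)).hasFDerivAt.comp_hasDerivAt t h1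
  rw [continuous_iff_continuousAt]
  intro z
  rw [ContinuousAt, Metric.tendsto_nhds]
  intro ε hε
  have hclose : ∀ᶠ w in 𝓝 z, ∀ t ∈ sphere (0 : ℂ) 1, ‖g (w + t • v) - g (z + t • v)‖ < ε / 2 := by
    refine (isCompact_sphere (0 : ℂ) 1).eventually_forall_of_forall_eventually fun t _ => ?_
    have hc : Continuous fun p : E × ℂ => ‖g (p.1 + p.2 • v) - g (z + p.2 • v)‖ := by
      have := hg.continuous
      fun_prop
    refine hc.continuousAt.eventually_lt continuousAt_const ?_
    simpa using hε
  filter_upwards [hclose] with w hw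
  have hd (t : ℂ) := (hline w t).fun_sub (hline z t)
  have hdiff : Differentiable ℂ fun t : ℂ => g (w + t • v) - g (z + t • v) :=
    fun t => (hd t).differentiableAt
  have hle := Complex.norm_deriv_le_of_forall_mem_sphere_norm_le one_pos
    (hdiff.diffContOnCl (s := ball 0 1)) fun t ht => (hw t ht).le
  rw [(hd 0).deriv] at hle
  simp only [zero_smul, add_zero, div_one] at hle
  rw [dist_eq_norm]
  linarith

end Holomorphic

section Cocycle

variable {E : Type*} [NormedAddCommGroup E] [NormedSpace ℂ E]

/-- The derivative at `z` of the `i`-th iterate of the bijection `e`. -/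
def derivCocycle (e : Equiv.Perm E) (i : ℤ) (z : E) : E →L[ℂ] E :=
  fderiv ℂ (⇑(e ^ i)) z

theorem derivCocycle_zero (e : Equiv.Perm E) (z : E) :
    derivCocycle e 0 z = ContinuousLinearMap.id ℂ E := by
  simp only [derivCocycle, zpow_zero, Equiv.Perm.coe_one]
  exact fderiv_id

theorem differentiable_zpow {e : Equiv.Perm E} (he : Differentiable ℂ e)
    (he' : Differentiable ℂ e.symm) (i : ℤ) : Differentiable ℂ (⇑(e ^ i)) := by
  induction i with
  | zero => simp
  | succ n ih =>
    rw [zpow_add_one, Equiv.Perm.coe_mul]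
    exact ih.comp he
  | pred n ih =>
    rw [zpow_sub_one, Equiv.Perm.coe_mul]
    exact ih.comp he'

variable {e : Equiv.Perm E}

theorem derivCocycle_add (he : ∀ i : ℤ, Differentiable ℂ (⇑(e ^ i))) (i j : ℤ) (z v : E) :
    derivCocycle e (i + j) z v = derivCocycle e i ((e ^ j) z) (derivCocycle e j z v) := by
  simp only [derivCocycle]
  rw [zpow_add, Equiv.Perm.coe_mul, fderiv_comp z (he i _) (he j _)]
  rfl

theorem derivCocycle_neg_apply (he : ∀ i : ℤ, Differentiable ℂ (⇑(e ^ i))) (i : ℤ) (z v : E) :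
    derivCocycle e (-i) ((e ^ i) z) (derivCocycle e i z v) = v := by
  rw [← derivCocycle_add he, neg_add_cancel, derivCocycle_zero]
  rfl

theorem derivCocycle_apply_neg (he : ∀ i : ℤ, Differentiable ℂ (⇑(e ^ i))) (i : ℤ) (z v : E) :
    derivCocycle e i z (derivCocycle e (-i) ((e ^ i) z) v) = v := by
  have h := derivCocycle_neg_apply he (-i) ((e ^ i) z) v
  rwa [neg_neg, ← Equiv.Perm.mul_apply, ← zpow_add, neg_add_cancel, zpow_zero,
    Equiv.Perm.one_apply] at h

theorem derivCocycle_one_apply (he : ∀ i : ℤ, Differentiable ℂ (⇑(e ^ i))) (i : ℤ) (z v : E) :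
    derivCocycle e 1 ((e ^ i) z) (derivCocycle e i z v) = derivCocycle e (i + 1) z v := by
  rw [add_comm, derivCocycle_add he]

/-- Solutions of the homogeneous recurrence are orbits of the cocycle. -/
theorem eq_derivCocycle_of_homogeneous (he : ∀ i : ℤ, Differentiable ℂ (⇑(e ^ i))) {z : E}
    {x : ℤ → E} (hx : ∀ i, x (i + 1) = derivCocycle e 1 ((e ^ i) z) (x i)) (i : ℤ) :
    x i = derivCocycle e i z (x 0) := by
  induction i with
  | zero => simp [derivCocycle_zero]
  | succ n ih => rw [hx, ih, derivCocycle_one_apply he]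
  | pred n ih =>
    have h := hx (-n - 1)
    rw [sub_add_cancel, ih] at h
    have h2 := derivCocycle_one_apply he (-n - 1) z (x 0)
    rw [sub_add_cancel, h] at h2
    have h3 := congrArg (derivCocycle e (-1) ((e ^ (1 : ℤ)) ((e ^ (-(n : ℤ) - 1)) z))) h2
    rwa [derivCocycle_neg_apply he, derivCocycle_neg_apply he, eq_comm] at h3

theorem eq_derivCocycle_add_of_homogeneous (he : ∀ i : ℤ, Differentiable ℂ (⇑(e ^ i))) {z : E}
    {x : ℤ → E} (hx : ∀ i, x (i + 1) = derivCocycle e 1 ((e ^ i) z) (x i)) (i n : ℤ) :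
    x i = derivCocycle e n ((e ^ (i - n)) z) (x (i - n)) := by
  have h := eq_derivCocycle_of_homogeneous he (z := (e ^ (i - n)) z) (x := fun j => x (i - n + j))
    (fun j => by
      rw [← Equiv.Perm.mul_apply, ← zpow_add, add_comm j (i - n), ← hx, add_assoc]) n
  simpa using h

/-- The Green operator of the cocycle associated with a family of projections `P`. -/
def green (e : Equiv.Perm E) (P : E → E →L[ℂ] E) (i : ℤ) (z : E) : E →L[ℂ] E :=
  if 0 ≤ i then (derivCocycle e i z).comp (P z)
  else -(derivCocycle e i z).comp (ContinuousLinearMap.id ℂ E - P z)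

theorem green_of_nonneg (e : Equiv.Perm E) (P : E → E →L[ℂ] E) {i : ℤ} (hi : 0 ≤ i) (z v : E) :
    green e P i z v = derivCocycle e i z (P z v) := by
  simp [green, hi]

theorem green_of_neg (e : Equiv.Perm E) (P : E → E →L[ℂ] E) {i : ℤ} (hi : i < 0) (z v : E) :
    green e P i z v = -derivCocycle e i z (v - P z v) := by
  simp [green, hi.not_ge]

theorem green_succ (he : ∀ i : ℤ, Differentiable ℂ (⇑(e ^ i))) (P : E → E →L[ℂ] E) (i : ℤ)
    (z v : E) :
    green e P (i + 1) z v - derivCocycle e 1 ((e ^ i) z) (green e P i z v) =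
      if i = -1 then v else 0 := by
  rcases lt_trichotomy i (-1) with hi | rfl | hi
  · rw [green_of_neg e P (by omega), green_of_neg e P (by omega), map_neg,
      derivCocycle_one_apply he, if_neg hi.ne, sub_self]
  · rw [green_of_nonneg e P (by omega), green_of_neg e P (by omega), map_neg,
      derivCocycle_one_apply he]
    simp [derivCocycle_zero]
  · rw [green_of_nonneg e P (by omega), green_of_nonneg e P (by omega),
      derivCocycle_one_apply he, if_neg hi.ne', sub_self]

theorem zpow_apply_mem {α : Type*} {e : Equiv.Perm α} {S : Set α} (hS : e ⁻¹' S = S) {z : α}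
    (hz : z ∈ S) (i : ℤ) : (e ^ i) z ∈ S := by
  have h1 : ∀ w, e w ∈ S ↔ w ∈ S := fun w => by rw [← mem_preimage, hS]
  induction i with
  | zero => simpa using hz
  | succ n ih =>
    rwa [add_comm, zpow_add, zpow_one, Equiv.Perm.mul_apply, h1]
  | pred n ih =>
    rwa [← h1, ← Equiv.Perm.mul_apply, ← zpow_one_add, add_sub_cancel]

end Cocycle
theorem summable_pow_natAbs {q : ℝ} (hq0 : 0 ≤ q) (hq1 : q < 1) :
    Summable fun n : ℤ => q ^ n.natAbs := by
  apply Summable.of_nat_of_neg <;> simpa using summable_geometric_of_lt_one hq0 hq1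

section Dichotomy

variable {E : Type*} [NormedAddCommGroup E] [NormedSpace ℂ E] {e : Equiv.Perm E} {S : Set E}

/-- If the Green operators decay exponentially, every bounded right-hand side of the recurrence
has a bounded solution, with uniform bounds. -/
theorem exists_bounded_solution_of_green [CompleteSpace E]
    (he : ∀ i : ℤ, Differentiable ℂ (⇑(e ^ i))) (hS : e ⁻¹' S = S) {P : E → E →L[ℂ] E} {C q : ℝ}
    (hC : 0 ≤ C) (hq0 : 0 ≤ q) (hq1 : q < 1)
    (hG : ∀ i : ℤ, ∀ z ∈ S, ∀ v, ‖green e P i z v‖ ≤ C * q ^ i.natAbs * ‖v‖) :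
    ∃ M > 0, ∀ z ∈ S, ∀ (η : ℤ → E) (B : ℝ), (∀ i, ‖η i‖ ≤ B) →
      ∃ ξ : ℤ → E, (∀ i, ξ (i + 1) - derivCocycle e 1 ((e ^ i) z) (ξ i) = η i) ∧
        ∀ i, ‖ξ i‖ ≤ M * B := by
  have hsum := summable_pow_natAbs hq0 hq1
  have hT : 0 ≤ ∑' n : ℤ, q ^ n.natAbs := tsum_nonneg fun n => by positivity
  refine ⟨C * (∑' n : ℤ, q ^ n.natAbs) + 1, by positivity, fun z hz η B hη => ?_⟩
  have hB : 0 ≤ B := (norm_nonneg _).trans (hη 0)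
  have hterm (i n : ℤ) : ‖green e P n ((e ^ (i - n)) z) (η (i - n - 1))‖ ≤
      C * B * q ^ n.natAbs := by
    refine (hG n _ (zpow_apply_mem hS hz _) _).trans ?_
    rw [mul_right_comm]
    gcongr
    exact hη _
  have hsummable (i : ℤ) : Summable fun n : ℤ => green e P n ((e ^ (i - n)) z) (η (i - n - 1)) :=
    .of_norm_bounded (hsum.mul_left (C * B)) (hterm i)
  refine ⟨fun i => ∑' n : ℤ, green e P n ((e ^ (i - n)) z) (η (i - n - 1)), fun i => ?_,
    fun i => ?_⟩
  · have hshift : (∑' n : ℤ, green e P n ((e ^ (i + 1 - n)) z) (η (i + 1 - n - 1))) =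
        ∑' n : ℤ, green e P (n + 1) ((e ^ (i - n)) z) (η (i - n - 1)) := by
      rw [← (Equiv.addRight (1 : ℤ)).tsum_eq]
      simp
    have hs : Summable fun n : ℤ => green e P (n + 1) ((e ^ (i - n)) z) (η (i - n - 1)) := by
      have := (Equiv.addRight (1 : ℤ)).summable_iff.2 (hsummable (i + 1))
      simpa [Function.comp_def] using this
    dsimp only
    rw [hshift, ContinuousLinearMap.map_tsum _ (hsummable i),
      ← hs.tsum_sub ((hsummable i).mapL _), tsum_eq_single (-1)]
    · have h := green_succ he P (-1) ((e ^ (i - -1)) z) (η (i - -1 - 1))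
      rw [← Equiv.Perm.mul_apply, ← zpow_add] at h
      simpa using h
    · intro n hn
      have h := green_succ he P n ((e ^ (i - n)) z) (η (i - n - 1))
      rw [← Equiv.Perm.mul_apply, ← zpow_add, if_neg hn] at h
      simpa using h
  · refine (tsum_of_norm_bounded (hsum.mul_left (C * B)).hasSum (hterm i)).trans ?_
    rw [tsum_mul_left]
    nlinarith

/-- If the projections commute with the cocycle and the Green operators decay exponentially, the
only bounded solution of the homogeneous recurrence is zero. -/
theorem eq_zero_of_homogeneous_of_green (he : ∀ i : ℤ, Differentiable ℂ (⇑(e ^ i)))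
    (hS : e ⁻¹' S = S) {P : E → E →L[ℂ] E} {C q K : ℝ} (hC : 0 ≤ C) (hq0 : 0 ≤ q) (hq1 : q < 1)
    (hG : ∀ i : ℤ, ∀ z ∈ S, ∀ v, ‖green e P i z v‖ ≤ C * q ^ i.natAbs * ‖v‖)
    (hPK : ∀ z ∈ S, ‖P z‖ ≤ K) (hPP : ∀ z ∈ S, ∀ v, P z (P z v) = P z v)
    (hcomm : ∀ z ∈ S, ∀ v, P (e z) (derivCocycle e 1 z v) = derivCocycle e 1 z (P z v))
    {z : E} (hz : z ∈ S) {x : ℤ → E} {B : ℝ} (hB : ∀ i, ‖x i‖ ≤ B)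
    (hx : ∀ i, x (i + 1) = derivCocycle e 1 ((e ^ i) z) (x i)) (i : ℤ) : x i = 0 := by
  have hB0 : 0 ≤ B := (norm_nonneg _).trans (hB 0)
  have hmem (j : ℤ) := zpow_apply_mem hS hz j
  have hp (j : ℤ) : P ((e ^ (j + 1)) z) (x (j + 1)) =
      derivCocycle e 1 ((e ^ j) z) (P ((e ^ j) z) (x j)) := by
    rw [hx, ← hcomm _ (hmem j), ← Equiv.Perm.mul_apply, ← zpow_one_add, add_comm]
  have hr (j : ℤ) : x (j + 1) - P ((e ^ (j + 1)) z) (x (j + 1)) =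
      derivCocycle e 1 ((e ^ j) z) (x j - P ((e ^ j) z) (x j)) := by
    rw [hp, map_sub, hx]
  have hbp (j : ℤ) : ‖P ((e ^ j) z) (x j)‖ ≤ K * B :=
    (ContinuousLinearMap.le_of_opNorm_le _ (hPK _ (hmem j)) _).trans <| by
      gcongr
      · exact (norm_nonneg _).trans (hPK _ hz)
      · exact hB j
  have hlim (a : ℝ) : Tendsto (fun n : ℕ => C * q ^ n * a) atTop (𝓝 0) := by
    simpa using ((tendsto_pow_atTop_nhds_zero_of_lt_one hq0 hq1).const_mul C).mul_const a
  have hp0 : P ((e ^ i) z) (x i) = 0 := by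
    refine norm_le_zero_iff.1 (ge_of_tendsto' (hlim (K * B)) fun n => ?_)
    have h := eq_derivCocycle_add_of_homogeneous he (z := z) (x := fun j => P ((e ^ j) z) (x j)) hp i n
    have h2 := hG n _ (hmem (i - n)) (P ((e ^ (i - n)) z) (x (i - n)))
    rw [green_of_nonneg e P (by omega), hPP _ (hmem _), ← h, Int.natAbs_natCast] at h2
    exact h2.trans (by gcongr; exact hbp _)
  have hr0 : x i - P ((e ^ i) z) (x i) = 0 := by
    refine norm_le_zero_iff.1 (ge_of_tendsto' ((hlim (B + K * B)).comp (tendsto_add_atTop_nat 1))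
      fun n => ?_)
    have h := eq_derivCocycle_add_of_homogeneous he (z := z)
      (x := fun j => x j - P ((e ^ j) z) (x j)) hr i (-(n + 1 : ℕ))
    have h2 := hG (-(n + 1 : ℕ)) _ (hmem (i - -(n + 1 : ℕ)))
      (x (i - -(n + 1 : ℕ)) - P ((e ^ (i - -(n + 1 : ℕ))) z) (x (i - -(n + 1 : ℕ))))
    rw [green_of_neg e P (by omega), map_sub (P _), hPP _ (hmem _), sub_self, sub_zero, ← h,
      norm_neg, Int.natAbs_neg, Int.natAbs_natCast] at h2
    refine h2.trans ?_
    dsimp only [Function.comp_apply]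
    gcongr
    exact (norm_sub_le _ _).trans (add_le_add (hB _) (hbp _))
  rwa [hp0, sub_zero] at hr0

/-- The bound of a bounded solution persists under a small linear perturbation. -/
theorem norm_le_of_perturbed_recurrence {A : ℤ → E →L[ℂ] E} {M : ℝ} (hM : 0 < M)
    (hA : ∀ (x : ℤ → E) (B C : ℝ), (∀ i, ‖x i‖ ≤ B) → (∀ i, ‖x (i + 1) - A i (x i)‖ ≤ C) →
      ∀ i, ‖x i‖ ≤ M * C)
    {x : ℤ → E} {B a : ℝ} (hB : ∀ i, ‖x i‖ ≤ B)
    (hx : ∀ i, ‖x (i + 1) - A i (x i)‖ ≤ a + (2 * M)⁻¹ * ‖x (i + 1)‖) (i : ℤ) :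
    ‖x i‖ ≤ 2 * M * a := by
  have hbdd : BddAbove (range fun i => ‖x i‖) := ⟨B, by rintro _ ⟨i, rfl⟩; exact hB i⟩
  have hsup (i : ℤ) : ‖x i‖ ≤ ⨆ i, ‖x i‖ := le_ciSup hbdd i
  have h1 := hA x B (a + (2 * M)⁻¹ * ⨆ i, ‖x i‖) hB fun i =>
    (hx i).trans (by gcongr; exact hsup _)
  have h2 : ⨆ i, ‖x i‖ ≤ M * (a + (2 * M)⁻¹ * ⨆ i, ‖x i‖) := ciSup_le h1
  have h3 : M * (a + (2 * M)⁻¹ * ⨆ i, ‖x i‖) = M * a + (⨆ i, ‖x i‖) / 2 := by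
    field_simp
  linarith [hsup i]

theorem abs_sub_pow_min_natAbs_le {μ : ℝ} (hμ : 1 ≤ μ) (n : ℕ) (i : ℤ) :
    |μ ^ min (i + 1).natAbs n - μ ^ min i.natAbs n| ≤ (μ - 1) * μ ^ min (i + 1).natAbs n := by
  have hpow (m : ℕ) : 0 ≤ μ ^ m := by positivity
  have hcases : min (i + 1).natAbs n = min i.natAbs n ∨
      min (i + 1).natAbs n = min i.natAbs n + 1 ∨ min i.natAbs n = min (i + 1).natAbs n + 1 := by
    omega
  rcases hcases with h | h | h <;> rw [h]
  · simpa using mul_nonneg (sub_nonneg.2 hμ) (hpow _)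
  · rw [pow_succ, abs_of_nonneg] <;>
      nlinarith [hpow (min i.natAbs n), mul_nonneg (hpow (min i.natAbs n)) (sq_nonneg (μ - 1))]
  · rw [pow_succ, abs_of_nonpos] <;> nlinarith [hpow (min (i + 1).natAbs n)]

/-- A bounded solution of the recurrence with right-hand side concentrated at `-1` decays
exponentially. -/
theorem norm_le_of_single_recurrence {A : ℤ → E →L[ℂ] E} {M μ : ℝ} (hM : 0 < M)
    (hμ : μ = 1 + (2 * M)⁻¹)
    (hA : ∀ (x : ℤ → E) (B C : ℝ), (∀ i, ‖x i‖ ≤ B) → (∀ i, ‖x (i + 1) - A i (x i)‖ ≤ C) →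
      ∀ i, ‖x i‖ ≤ M * C)
    {x : ℤ → E} {B : ℝ} {v : E} (hB : ∀ i, ‖x i‖ ≤ B)
    (hx : ∀ i, x (i + 1) - A i (x i) = if i = -1 then v else 0) (i : ℤ) :
    ‖x i‖ ≤ 2 * M * μ * μ⁻¹ ^ i.natAbs * ‖v‖ := by
  have hμ1 : 1 ≤ μ := by rw [hμ]; linarith [inv_pos.2 (mul_pos two_pos hM)]
  have hμ0 : 0 < μ := by linarith
  set n := i.natAbs with hn
  let c : ℤ → ℝ := fun j => μ ^ min j.natAbs n
  have hc0 (j : ℤ) : 0 < c j := by positivity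
  have hnorm (j : ℤ) (w : E) : ‖(c j : ℂ) • w‖ = c j * ‖w‖ := by
    rw [norm_smul, Complex.norm_real, Real.norm_of_nonneg (hc0 j).le]
  have hcle (j : ℤ) : c j ≤ μ ^ n := pow_le_pow_right₀ hμ1 (min_le_right _ _)
  have hkey := norm_le_of_perturbed_recurrence hM hA (x := fun j => (c j : ℂ) • x j)
    (B := μ ^ n * B) (a := μ * ‖v‖) (fun j => by
      rw [hnorm]
      exact mul_le_mul (hcle j) (hB j) (norm_nonneg _) (by positivity)) (fun j => ?_) i
  · rw [hnorm] at hkey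
    have hci : c i = μ ^ n := by simp [c, hn]
    rw [hci] at hkey
    rw [inv_pow, show 2 * M * μ * (μ ^ n)⁻¹ * ‖v‖ = (2 * M * (μ * ‖v‖)) / μ ^ n by
      rw [div_eq_mul_inv]; ring, le_div_iff₀ (by positivity)]
    linarith
  · have hsplit : (c (j + 1) : ℂ) • x (j + 1) - A j ((c j : ℂ) • x j) =
        ((c (j + 1) - c j : ℝ) : ℂ) • x (j + 1) + (c j : ℂ) • (x (j + 1) - A j (x j)) := by
      rw [map_smul, Complex.ofReal_sub, sub_smul, smul_sub]
      abel
    rw [hsplit, hx, add_comm]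
    refine (norm_add_le _ _).trans (add_le_add ?_ ?_)
    · split_ifs with hj
      · rw [hnorm]
        gcongr
        calc c j ≤ μ ^ 1 := pow_le_pow_right₀ hμ1 (by subst hj; exact min_le_left _ _)
          _ = μ := pow_one μ
      · simpa using mul_nonneg hμ0.le (norm_nonneg v)
    · rw [norm_smul, Complex.norm_real, Real.norm_eq_abs, hnorm, ← mul_assoc]
      gcongr
      have := abs_sub_pow_min_natAbs_le hμ1 n j
      rwa [hμ, add_sub_cancel_left, ← hμ] at this

/-- Vectors with bounded forward orbit. -/
def stableSpace (e : Equiv.Perm E) (z : E) : Submodule ℂ E where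
  carrier := {v | ∃ C : ℝ, ∀ i : ℤ, 0 ≤ i → ‖derivCocycle e i z v‖ ≤ C}
  zero_mem' := ⟨0, fun i _ => by simp⟩
  add_mem' := by
    rintro v w ⟨C, hC⟩ ⟨D, hD⟩
    refine ⟨C + D, fun i hi => ?_⟩
    rw [map_add]
    exact (norm_add_le _ _).trans (add_le_add (hC i hi) (hD i hi))
  smul_mem' := by
    rintro a v ⟨C, hC⟩
    refine ⟨‖a‖ * C, fun i hi => ?_⟩
    rw [map_smul, norm_smul]
    exact mul_le_mul_of_nonneg_left (hC i hi) (norm_nonneg a)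

/-- Vectors with bounded backward orbit. -/
def unstableSpace (e : Equiv.Perm E) (z : E) : Submodule ℂ E where
  carrier := {v | ∃ C : ℝ, ∀ i : ℤ, i ≤ 0 → ‖derivCocycle e i z v‖ ≤ C}
  zero_mem' := ⟨0, fun i _ => by simp⟩
  add_mem' := by
    rintro v w ⟨C, hC⟩ ⟨D, hD⟩
    refine ⟨C + D, fun i hi => ?_⟩
    rw [map_add]
    exact (norm_add_le _ _).trans (add_le_add (hC i hi) (hD i hi))
  smul_mem' := by
    rintro a v ⟨C, hC⟩
    refine ⟨‖a‖ * C, fun i hi => ?_⟩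
    rw [map_smul, norm_smul]
    exact mul_le_mul_of_nonneg_left (hC i hi) (norm_nonneg a)

theorem derivCocycle_shift (he : ∀ i : ℤ, Differentiable ℂ (⇑(e ^ i))) (i : ℤ) (z v : E) :
    derivCocycle e i (e z) (derivCocycle e 1 z v) = derivCocycle e (i + 1) z v := by
  rw [derivCocycle_add he, zpow_one]

theorem exists_derivCocycle_one_eq (he : ∀ i : ℤ, Differentiable ℂ (⇑(e ^ i))) (z w : E) :
    ∃ v, derivCocycle e 1 z v = w :=
  ⟨_, derivCocycle_apply_neg he 1 z w⟩

theorem map_stableSpace (he : ∀ i : ℤ, Differentiable ℂ (⇑(e ^ i))) (z : E) :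
    (stableSpace e z).map (derivCocycle e 1 z).toLinearMap = stableSpace e (e z) := by
  ext w
  constructor
  · rintro ⟨v, ⟨C, hC⟩, rfl⟩
    exact ⟨C, fun i hi => by
      simpa [derivCocycle_shift he] using hC (i + 1) (by omega)⟩
  · rintro ⟨C, hC⟩
    obtain ⟨v, rfl⟩ := exists_derivCocycle_one_eq he z w
    refine ⟨v, ⟨max C ‖v‖, fun i hi => ?_⟩, rfl⟩
    rcases hi.eq_or_lt with rfl | hi
    · simp [derivCocycle_zero]
    · have h := hC (i - 1) (by omega)
      rw [derivCocycle_shift he, sub_add_cancel] at h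
      exact h.trans (le_max_left _ _)

theorem map_unstableSpace (he : ∀ i : ℤ, Differentiable ℂ (⇑(e ^ i))) (z : E) :
    (unstableSpace e z).map (derivCocycle e 1 z).toLinearMap = unstableSpace e (e z) := by
  ext w
  constructor
  · rintro ⟨v, ⟨C, hC⟩, rfl⟩
    refine ⟨max C ‖derivCocycle e 1 z v‖, fun i hi => ?_⟩
    rcases hi.eq_or_lt with rfl | hi
    · simp [derivCocycle_zero]
    · have h := hC (i + 1) (by omega)
      rw [← derivCocycle_shift he] at h
      exact h.trans (le_max_left _ _)
  · rintro ⟨C, hC⟩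
    obtain ⟨v, rfl⟩ := exists_derivCocycle_one_eq he z w
    refine ⟨v, ⟨C, fun i hi => ?_⟩, rfl⟩
    have h := hC (i - 1) (by omega)
    rwa [derivCocycle_shift he, sub_add_cancel] at h

theorem isCompl_stableSpace_unstableSpace (he : ∀ i : ℤ, Differentiable ℂ (⇑(e ^ i))) {z : E}
    {M : ℝ}
    (hA : ∀ (x : ℤ → E) (B C : ℝ), (∀ i, ‖x i‖ ≤ B) →
      (∀ i, ‖x (i + 1) - derivCocycle e 1 ((e ^ i) z) (x i)‖ ≤ C) → ∀ i, ‖x i‖ ≤ M * C)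
    (hex : ∀ v : E, ∃ (x : ℤ → E) (B : ℝ), (∀ i, ‖x i‖ ≤ B) ∧
      ∀ i, x (i + 1) - derivCocycle e 1 ((e ^ i) z) (x i) = if i = -1 then v else 0) :
    IsCompl (stableSpace e z) (unstableSpace e z) := by
  constructor
  · rw [Submodule.disjoint_def]
    rintro v ⟨C, hC⟩ ⟨D, hD⟩
    have h := hA (fun i => derivCocycle e i z v) (max C D) 0 (fun i => ?_) (fun i => ?_) 0
    · simpa [derivCocycle_zero] using h
    · rcases le_total 0 i with hi | hi
      · exact (hC i hi).trans (le_max_left _ _)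
      · exact (hD i hi).trans (le_max_right _ _)
    · rw [derivCocycle_one_apply he, sub_self, norm_zero]
  · rw [codisjoint_iff, eq_top_iff]
    intro v _
    obtain ⟨x, B, hB, hx⟩ := hex v
    have hhom (i : ℤ) : x i - green e (fun _ => ContinuousLinearMap.id ℂ E) i z v =
        derivCocycle e i z (x 0 - v) := by
      have h := eq_derivCocycle_of_homogeneous he (z := z)
        (x := fun i => x i - green e (fun _ => ContinuousLinearMap.id ℂ E) i z v) (fun j => by
          have h1 := hx j
          rw [← green_succ he (fun _ => ContinuousLinearMap.id ℂ E) j z v] at h1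
          rw [map_sub, sub_eq_sub_iff_sub_eq_sub, h1]) i
      simpa [green_of_nonneg e _ le_rfl, derivCocycle_zero] using h
    refine Submodule.mem_sup.2 ⟨x 0, ⟨B, fun i hi => ?_⟩, v - x 0, ⟨max B ‖v - x 0‖, fun i hi => ?_⟩,
      add_sub_cancel _ _⟩
    · have h := hhom i
      rw [green_of_nonneg e _ hi, map_sub] at h
      simp only [ContinuousLinearMap.id_apply, sub_left_inj] at h
      rw [← h]
      exact hB i
    · rcases hi.eq_or_lt with rfl | hi
      · simp [derivCocycle_zero]
      · have h := hhom i
        rw [green_of_neg e _ hi] at h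
        simp only [ContinuousLinearMap.id_apply, sub_self, map_zero, neg_zero, sub_zero] at h
        rw [← neg_sub, map_neg, norm_neg, ← h]
        exact (hB i).trans (le_max_left _ _)

/-- The projection onto the stable space along the unstable space, whenever they are
complementary. -/
def stableProj [FiniteDimensional ℂ E] (e : Equiv.Perm E) (z : E) : E →L[ℂ] E :=
  open Classical in
  if h : IsCompl (stableSpace e z) (unstableSpace e z) then
    ((stableSpace e z).projection (unstableSpace e z) h).toContinuousLinearMap
  else 0

section StableProj

variable [FiniteDimensional ℂ E] {z : E}

theorem stableProj_apply (h : IsCompl (stableSpace e z) (unstableSpace e z))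
    (v : E) :
    stableProj e z v = (stableSpace e z).projection (unstableSpace e z) h v := by
  simp [stableProj, h]

theorem stableProj_mem (h : IsCompl (stableSpace e z) (unstableSpace e z))
    (v : E) : stableProj e z v ∈ stableSpace e z := by
  rw [stableProj_apply h]
  exact Submodule.projection_apply_mem h v

theorem sub_stableProj_mem (h : IsCompl (stableSpace e z) (unstableSpace e z))
    (v : E) : v - stableProj e z v ∈ unstableSpace e z := by
  rw [stableProj_apply h]
  exact Submodule.sub_projection_mem h v

theorem stableProj_of_mem_stableSpace (h : IsCompl (stableSpace e z) (unstableSpace e z))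
    {v : E} (hv : v ∈ stableSpace e z) :
    stableProj e z v = v := by
  rw [stableProj_apply h]
  exact Submodule.projection_apply_of_mem_left h hv

theorem stableProj_of_mem_unstableSpace (h : IsCompl (stableSpace e z) (unstableSpace e z))
    {v : E} (hv : v ∈ unstableSpace e z) :
    stableProj e z v = 0 := by
  rw [stableProj_apply h]
  exact (Submodule.projection_apply_eq_zero_iff h).2 hv

theorem exists_bound_green_stableProj (h : IsCompl (stableSpace e z) (unstableSpace e z))
    (v : E) :
    ∃ B : ℝ, ∀ i, ‖green e (stableProj e) i z v‖ ≤ B := by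
  obtain ⟨C, hC⟩ := stableProj_mem h v
  obtain ⟨D, hD⟩ := sub_stableProj_mem h v
  refine ⟨max C D, fun i => ?_⟩
  rcases le_or_gt 0 i with hi | hi
  · rw [green_of_nonneg e _ hi]
    exact (hC i hi).trans (le_max_left _ _)
  · rw [green_of_neg e _ hi, norm_neg]
    exact (hD i hi.le).trans (le_max_right _ _)

end StableProj

/-- A bounded inverse of the recurrence operator along every orbit makes the stable projection
continuous. -/
theorem continuousOn_stableProj [FiniteDimensional ℂ E]
    (he : ∀ i : ℤ, Differentiable ℂ (⇑(e ^ i))) (hS : e ⁻¹' S = S) (hSc : IsCompact S)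
    {M C q : ℝ} (hM : 0 < M) (hq0 : 0 ≤ q) (hq1 : q < 1)
    (hA : ∀ z ∈ S, ∀ (x : ℤ → E) (B C : ℝ), (∀ i, ‖x i‖ ≤ B) →
      (∀ i, ‖x (i + 1) - derivCocycle e 1 ((e ^ i) z) (x i)‖ ≤ C) → ∀ i, ‖x i‖ ≤ M * C)
    (hc : ∀ z ∈ S, IsCompl (stableSpace e z) (unstableSpace e z))
    (hG : ∀ z ∈ S, ∀ v i, ‖green e (stableProj e) i z v‖ ≤ C * q ^ i.natAbs * ‖v‖) :
    ContinuousOn (stableProj e) S := by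
  have hD : Continuous (derivCocycle e 1) := (he 1).continuous_fderiv_complex
  obtain ⟨K, hK⟩ := hSc.exists_bound_of_continuousOn hD.continuousOn
  rw [continuousOn_clm_apply]
  intro v z hz
  have hK0 : 0 ≤ K := (norm_nonneg _).trans (hK z hz)
  rw [ContinuousWithinAt, Metric.tendsto_nhds]
  intro ε hε
  have hδ : 0 < ε / (2 * M) := by positivity
  have hlim : Tendsto (fun n : ℕ => 2 * K * (C * q ^ n * ‖v‖)) atTop (𝓝 0) := by
    simpa using ((((tendsto_pow_atTop_nhds_zero_of_lt_one hq0 hq1).const_mul C).mul_const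
      ‖v‖).const_mul (2 * K))
  obtain ⟨N, hN⟩ := eventually_atTop.1 (hlim.eventually_lt_const hδ)
  have hnear : ∀ᶠ w in 𝓝[S] z, ∀ i ∈ Finset.Icc (-N : ℤ) N,
      ‖derivCocycle e 1 ((e ^ i) w) (green e (stableProj e) i z v) -
        derivCocycle e 1 ((e ^ i) z) (green e (stableProj e) i z v)‖ < ε / (2 * M) := by
    rw [Filter.eventually_all_finset]
    intro i _
    have hcont : Continuous fun w =>
        ‖derivCocycle e 1 ((e ^ i) w) (green e (stableProj e) i z v) -
          derivCocycle e 1 ((e ^ i) z) (green e (stableProj e) i z v)‖ :=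
      (((hD.comp (he i).continuous).clm_apply continuous_const).sub continuous_const).norm
    refine nhdsWithin_le_nhds (hcont.continuousAt.eventually_lt continuousAt_const ?_)
    simpa using hδ
  filter_upwards [hnear, self_mem_nhdsWithin] with w hw hwS
  obtain ⟨B, hB⟩ := exists_bound_green_stableProj (hc z hz) v
  obtain ⟨B', hB'⟩ := exists_bound_green_stableProj (hc w hwS) v
  have h := hA w hwS
    (fun i => green e (stableProj e) i w v - green e (stableProj e) i z v) (B' + B) (ε / (2 * M))
    (fun i => (norm_sub_le _ _).trans (add_le_add (hB' i) (hB i))) (fun i => ?_) 0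
  · rw [green_of_nonneg e _ le_rfl, green_of_nonneg e _ le_rfl, derivCocycle_zero,
      derivCocycle_zero, ContinuousLinearMap.id_apply, ContinuousLinearMap.id_apply] at h
    rw [dist_eq_norm]
    refine h.trans_lt ?_
    have : M * (ε / (2 * M)) = ε / 2 := by field_simp
    linarith
  · have h1 := green_succ he (stableProj e) i z v
    rw [← green_succ he (stableProj e) i w v] at h1
    have h2 : green e (stableProj e) (i + 1) w v - green e (stableProj e) (i + 1) z v -
        derivCocycle e 1 ((e ^ i) w)
          (green e (stableProj e) i w v - green e (stableProj e) i z v) =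
        derivCocycle e 1 ((e ^ i) w) (green e (stableProj e) i z v) -
          derivCocycle e 1 ((e ^ i) z) (green e (stableProj e) i z v) := by
      rw [map_sub]
      rw [sub_eq_sub_iff_add_eq_add] at h1 ⊢
      rw [← sub_eq_zero] at h1 ⊢
      rw [← neg_eq_zero, ← h1]
      abel
    rw [h2]
    by_cases hi : i ∈ Finset.Icc (-N : ℤ) N
    · exact (hw i hi).le
    · have hNi : N ≤ i.natAbs := by
        rw [Finset.mem_Icc] at hi
        omega
      have hbound (y : E) (hy : y ∈ S) :
          ‖derivCocycle e 1 ((e ^ i) y) (green e (stableProj e) i z v)‖ ≤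
            K * (C * q ^ i.natAbs * ‖v‖) :=
        (ContinuousLinearMap.le_of_opNorm_le _ (hK _ (zpow_apply_mem hS hy i)) _).trans
          (mul_le_mul_of_nonneg_left (hG z hz v i) hK0)
      have h3 := hN _ hNi
      exact (norm_sub_le _ _).trans (by linarith [hbound w hwS, hbound z hz])

theorem fderiv_iterate_eq_derivCocycle (e : Equiv.Perm E) (n : ℕ) (z : E) :
    fderiv ℂ ((⇑e)^[n]) z = derivCocycle e n z := by
  rw [derivCocycle, zpow_natCast, Equiv.Perm.coe_pow]

theorem fderiv_symm_iterate_eq_derivCocycle (e : Equiv.Perm E) (n : ℕ) (z : E) :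
    fderiv ℂ ((⇑e.symm)^[n]) z = derivCocycle e (-n) z := by
  rw [derivCocycle, zpow_neg, zpow_natCast, ← inv_pow, Equiv.Perm.coe_pow]
  rfl

theorem fderiv_eq_derivCocycle_one (e : Equiv.Perm E) (z : E) :
    fderiv ℂ e z = derivCocycle e 1 z := by
  rw [derivCocycle, zpow_one]

/-- A hyperbolic set carries invariant projections whose Green operators decay exponentially. -/
theorem IsHyperbolicSet.exists_green_bound (h : IsHyperbolicSet e e.symm S) (hSc : IsCompact S) :
    ∃ (P : E → E →L[ℂ] E) (C q K : ℝ), 0 ≤ C ∧ 0 ≤ q ∧ q < 1 ∧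
      (∀ i : ℤ, ∀ z ∈ S, ∀ v, ‖green e P i z v‖ ≤ C * q ^ i.natAbs * ‖v‖) ∧
      (∀ z ∈ S, ‖P z‖ ≤ K) ∧ (∀ z ∈ S, ∀ v, P z (P z v) = P z v) ∧
      (∀ z ∈ S, e z ∈ S → ∀ v, P (e z) (derivCocycle e 1 z v) = derivCocycle e 1 z (P z v)) := by
  obtain ⟨Es, Eu, P, Cs, Cu, ls, lu, hCs, hCu, hls0, hls1, hlu1, hPc, hPmem, hPs, hPu, hmaps, hmapu,
    hs, hu⟩ := h
  obtain ⟨K, hK⟩ := hSc.exists_bound_of_continuousOn hPc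
  have hlu0 : 0 < lu := by linarith
  set q := max ls lu⁻¹ with hq
  have hq0 : 0 ≤ q := hls0.le.trans (le_max_left _ _)
  have hq1 : q < 1 := max_lt hls1 (inv_lt_one_of_one_lt₀ hlu1)
  have hPle (z : E) (hz : z ∈ S) (v : E) : ‖P z v‖ ≤ (1 + |K|) * ‖v‖ :=
    ContinuousLinearMap.le_of_opNorm_le _ ((hK z hz).trans (by linarith [le_abs_self K])) v
  have hQle (z : E) (hz : z ∈ S) (v : E) : ‖v - P z v‖ ≤ (1 + |K|) * ‖v‖ := by
    have := ContinuousLinearMap.le_of_opNorm_le _ ((hK z hz).trans (le_abs_self K)) v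
    exact (norm_sub_le _ _).trans (by linarith)
  refine ⟨P, (1 + Cs + Cu) * (1 + |K|), q, K, by positivity, hq0, hq1, fun i z hz v => ?_, hK,
    fun z hz v => hPs z hz _ (hPmem z hz v).1, fun z hz hez v => ?_⟩
  · have hgoal {D r w : ℝ} {n : ℕ} (hD0 : 0 ≤ D) (hD : D ≤ 1 + Cs + Cu) (hr0 : 0 ≤ r)
        (hr : r ≤ q) (hw0 : 0 ≤ w) (hw : w ≤ (1 + |K|) * ‖v‖) :
        D * r ^ n * w ≤ (1 + Cs + Cu) * (1 + |K|) * q ^ n * ‖v‖ := by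
      calc D * r ^ n * w ≤ (1 + Cs + Cu) * q ^ n * ((1 + |K|) * ‖v‖) := by gcongr
        _ = _ := by ring
    rcases lt_trichotomy i 0 with hi | rfl | hi
    · rw [green_of_neg e P hi, norm_neg]
      have h1 := hu z hz i.natAbs (by omega) _ (hPmem z hz v).2
      rw [fderiv_symm_iterate_eq_derivCocycle, show (-(i.natAbs : ℤ)) = i by omega,
        ← inv_pow] at h1
      exact h1.trans (hgoal hCu.le (by linarith) (by positivity) (le_max_right _ _)
        (norm_nonneg _) (hQle z hz v))
    · rw [green_of_nonneg e P le_rfl, derivCocycle_zero]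
      have := hgoal (D := 1) (r := 0) (n := 0) zero_le_one (by linarith) le_rfl hq0
        (norm_nonneg (P z v)) (hPle z hz v)
      simpa using this
    · rw [green_of_nonneg e P hi.le]
      have h1 := hs z hz i.natAbs (by omega) _ (hPmem z hz v).1
      rw [fderiv_iterate_eq_derivCocycle, show (i.natAbs : ℤ) = i by omega] at h1
      exact h1.trans (hgoal hCs.le (by linarith) hls0.le (le_max_left _ _)
        (norm_nonneg _) (hPle z hz v))
  · have h1 : derivCocycle e 1 z (P z v) ∈ Es (e z) := by
      rw [← hmaps z hz, fderiv_eq_derivCocycle_one]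
      exact Submodule.mem_map_of_mem (hPmem z hz v).1
    have h2 : derivCocycle e 1 z (v - P z v) ∈ Eu (e z) := by
      rw [← hmapu z hz, fderiv_eq_derivCocycle_one]
      exact Submodule.mem_map_of_mem (hPmem z hz v).2
    have h3 := hPu _ hez _ h2
    rw [map_sub, map_sub, hPs _ hez _ h1, sub_eq_zero] at h3
    exact h3

/-- If the recurrence operator is boundedly invertible along every orbit, uniformly in the orbit,
then the invariant set is hyperbolic. -/
theorem isHyperbolicSet_of_bounded_inverse [FiniteDimensional ℂ E]
    (he : ∀ i : ℤ, Differentiable ℂ (⇑(e ^ i))) (hS : e ⁻¹' S = S) (hSc : IsCompact S)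
    {M : ℝ} (hM : 0 < M)
    (hA : ∀ z ∈ S, ∀ (x : ℤ → E) (B C : ℝ), (∀ i, ‖x i‖ ≤ B) →
      (∀ i, ‖x (i + 1) - derivCocycle e 1 ((e ^ i) z) (x i)‖ ≤ C) → ∀ i, ‖x i‖ ≤ M * C)
    (hex : ∀ z ∈ S, ∀ v : E, ∃ (x : ℤ → E) (B : ℝ), (∀ i, ‖x i‖ ≤ B) ∧
      ∀ i, x (i + 1) - derivCocycle e 1 ((e ^ i) z) (x i) = if i = -1 then v else 0) :
    IsHyperbolicSet e e.symm S := by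
  obtain ⟨μ, hμ⟩ : ∃ μ, μ = 1 + (2 * M)⁻¹ := ⟨_, rfl⟩
  have hμ1 : 1 < μ := by rw [hμ]; linarith [inv_pos.2 (mul_pos two_pos hM)]
  have hμ0 : 0 < μ := by linarith
  have hc (z : E) (hz : z ∈ S) : IsCompl (stableSpace e z) (unstableSpace e z) :=
    isCompl_stableSpace_unstableSpace he (hA z hz) (hex z hz)
  have hG (z : E) (hz : z ∈ S) (v : E) (i : ℤ) :
      ‖green e (stableProj e) i z v‖ ≤ 2 * M * μ * μ⁻¹ ^ i.natAbs * ‖v‖ := by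
    obtain ⟨B, hB⟩ := exists_bound_green_stableProj (hc z hz) v
    exact norm_le_of_single_recurrence (x := fun i => green e (stableProj e) i z v) hM hμ
      (hA z hz) hB (fun j => green_succ he (stableProj e) j z v) i
  refine ⟨stableSpace e, unstableSpace e, stableProj e, 2 * M * μ, 2 * M * μ, μ⁻¹, μ,
    by positivity, by positivity, by positivity, inv_lt_one_of_one_lt₀ hμ1, hμ1,
    continuousOn_stableProj he hS hSc hM (by positivity) (inv_lt_one_of_one_lt₀ hμ1) hA hc hG,
    fun z hz v => ⟨stableProj_mem (hc z hz) v, sub_stableProj_mem (hc z hz) v⟩,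
    fun z hz v hv => stableProj_of_mem_stableSpace (hc z hz) hv,
    fun z hz v hv => stableProj_of_mem_unstableSpace (hc z hz) hv,
    fun z _ => ?_, fun z _ => ?_, fun z hz n hn v hv => ?_, fun z hz n hn v hv => ?_⟩
  · rw [fderiv_eq_derivCocycle_one, map_stableSpace he]
  · rw [fderiv_eq_derivCocycle_one, map_unstableSpace he]
  · have h := hG z hz v n
    rwa [green_of_nonneg e _ (by omega), stableProj_of_mem_stableSpace (hc z hz) hv,
      ← fderiv_iterate_eq_derivCocycle, Int.natAbs_natCast] at h
  · have h := hG z hz v (-n)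
    rwa [green_of_neg e _ (by omega), stableProj_of_mem_unstableSpace (hc z hz) hv, sub_zero,
      norm_neg, ← fderiv_symm_iterate_eq_derivCocycle, Int.natAbs_neg, Int.natAbs_natCast,
      inv_pow] at h

end Dichotomy

theorem orbitZ_eq_zpow {α : Type*} (e : Equiv.Perm α) (z : α) (i : ℤ) :
    orbitZ e e.symm z i = (e ^ i) z := by
  unfold orbitZ
  split_ifs with hi
  · obtain ⟨n, rfl⟩ := Int.eq_ofNat_of_zero_le hi
    simp [Equiv.Perm.coe_pow]
  · obtain ⟨n, hn⟩ := Int.eq_ofNat_of_zero_le (show 0 ≤ -i by omega)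
    rw [hn, show i = -(n : ℤ) by omega, zpow_neg, zpow_natCast, ← inv_pow, Equiv.Perm.coe_pow]
    rfl

theorem memℓp_infty_of_norm_le {E : Type*} [NormedAddCommGroup E] {x : ℤ → E} {B : ℝ}
    (hB : ∀ i, ‖x i‖ ≤ B) :
    Memℓp (E := fun _ : ℤ => E) x ∞ :=
  memℓp_infty ⟨B, by rintro _ ⟨i, rfl⟩; exact hB i⟩

section LpBridge

variable {E : Type*} [NormedAddCommGroup E] [NormedSpace ℂ E]

/-- Unique bounded solvability for right-hand sides of norm one, with a uniform bound, gives the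
corresponding estimate for all bounded sequences. -/
theorem norm_le_of_unique_solution [Nontrivial E] {A : ℤ → E →L[ℂ] E} {M : ℝ}
    (h : ∀ η : lp (fun _ : ℤ => E) ∞, ‖η‖ = 1 → ∃ ξ : lp (fun _ : ℤ => E) ∞,
      (∀ i : ℤ, ξ (i + 1) - A i (ξ i) = η i) ∧ ‖ξ‖ ≤ M ∧
        ∀ ξ' : lp (fun _ : ℤ => E) ∞, (∀ i : ℤ, ξ' (i + 1) - A i (ξ' i) = η i) → ξ' = ξ)
    (hM : 0 < M) (x : ℤ → E) (B C : ℝ) (hB : ∀ i, ‖x i‖ ≤ B)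
    (hC : ∀ i, ‖x (i + 1) - A i (x i)‖ ≤ C) (i : ℤ) : ‖x i‖ ≤ M * C := by
  have hC0 : 0 ≤ C := (norm_nonneg _).trans (hC 0)
  let ξ : lp (fun _ : ℤ => E) ∞ := ⟨x, memℓp_infty_of_norm_le hB⟩
  let η : lp (fun _ : ℤ => E) ∞ := ⟨fun i => x (i + 1) - A i (x i), memℓp_infty_of_norm_le hC⟩
  have hξη (i : ℤ) : ξ (i + 1) - A i (ξ i) = η i := rfl
  have hηC : ‖η‖ ≤ C := lp.norm_le_of_forall_le hC0 hC
  suffices hξ : ‖ξ‖ ≤ M * ‖η‖ from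
    (lp.norm_apply_le_norm (by simp) ξ i).trans (hξ.trans (by gcongr))
  by_cases hη : η = 0
  · obtain ⟨u, hu⟩ := exists_ne (0 : E)
    obtain ⟨η', hη'⟩ : ∃ η' : lp (fun _ : ℤ => E) ∞, ‖η'‖ = 1 :=
      ⟨lp.single ∞ 0 ((‖u‖⁻¹ : ℂ) • u), by
        rw [lp.norm_single (by simp)]
        exact norm_smul_inv_norm (𝕜 := ℂ) hu⟩
    obtain ⟨ξ', h1, -, h2⟩ := h η' hη'
    have h3 := h2 (ξ' + ξ) fun i => by
      have h4 := hξη i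
      rw [hη] at h4
      rw [← h1 i, lp.coeFn_add, Pi.add_apply, Pi.add_apply, map_add, add_sub_add_comm, h4]
      simp
    rw [add_eq_left] at h3
    simp [h3, hη]
  · obtain ⟨ξ', -, h1, h2⟩ := h ((‖η‖⁻¹ : ℂ) • η) (norm_smul_inv_norm (𝕜 := ℂ) hη)
    have h3 := h2 ((‖η‖⁻¹ : ℂ) • ξ) fun i => by
      rw [lp.coeFn_smul, lp.coeFn_smul, Pi.smul_apply, Pi.smul_apply, Pi.smul_apply, map_smul,
        ← smul_sub, hξη]
    have hpos : 0 < ‖η‖ := norm_pos_iff.2 hη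
    rw [← h3, norm_smul, norm_inv, Complex.norm_real, norm_norm, inv_mul_le_iff₀ hpos] at h1
    linarith

theorem exists_single_solution {A : ℤ → E →L[ℂ] E} {M : ℝ}
    (h : ∀ η : lp (fun _ : ℤ => E) ∞, ‖η‖ = 1 → ∃ ξ : lp (fun _ : ℤ => E) ∞,
      (∀ i : ℤ, ξ (i + 1) - A i (ξ i) = η i) ∧ ‖ξ‖ ≤ M ∧
        ∀ ξ' : lp (fun _ : ℤ => E) ∞, (∀ i : ℤ, ξ' (i + 1) - A i (ξ' i) = η i) → ξ' = ξ)
    (j : ℤ) (v : E) : ∃ (x : ℤ → E) (B : ℝ), (∀ i, ‖x i‖ ≤ B) ∧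
      ∀ i, x (i + 1) - A i (x i) = if i = j then v else 0 := by
  by_cases hv : v = 0
  · exact ⟨0, 0, by simp, by simp [hv]⟩
  · have hv' : (‖v‖ : ℂ) ≠ 0 := by simpa using hv
    obtain ⟨ξ, h1, -, -⟩ := h (lp.single ∞ j ((‖v‖⁻¹ : ℂ) • v)) (by
      rw [lp.norm_single (by simp)]
      exact norm_smul_inv_norm (𝕜 := ℂ) hv)
    refine ⟨fun i => (‖v‖ : ℂ) • ξ i, ‖v‖ * ‖ξ‖, fun i => ?_, fun i => ?_⟩
    · rw [norm_smul, Complex.norm_real, norm_norm]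
      gcongr
      exact lp.norm_apply_le_norm (by simp) ξ i
    · rw [map_smul, ← smul_sub, h1, lp.coeFn_single, Pi.single_apply]
      split_ifs
      · rw [smul_smul, mul_inv_cancel₀ hv', one_smul]
      · rw [smul_zero]

end LpBridge

/-- A compact invariant set `S` of a diffeomorphism `f` of `ℂ^k` (`k ≥ 2`) is
uniformly hyperbolic iff there is `M > 0` such that for every `z₀ ∈ S` and every
bounded sequence `η` with `‖η‖_∞ = 1`, the recurrence
`ξ_{i+1} − Df(f^i(z₀))·ξ_i = η_i` (`i ∈ ℤ`) has a unique bounded solution `ξ`,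
which moreover satisfies `‖ξ‖_∞ ≤ M`. -/
theorem hyperbolic_iff_unique_bounded_solution (k : ℕ) (hk : 2 ≤ k)
    (f finv : Ck k → Ck k) (hf : Differentiable ℂ f) (hfinv : Differentiable ℂ finv)
    (hli : Function.LeftInverse finv f) (hri : Function.RightInverse finv f)
    (S : Set (Ck k)) (hS : IsCompact S) (hinvS : Invariant f S) :
    IsHyperbolicSet f finv S ↔
      ∃ M > 0, ∀ z0 ∈ S, ∀ η : lp (fun _ : ℤ => Ck k) ∞, ‖η‖ = 1 →
        ∃ ξ : lp (fun _ : ℤ => Ck k) ∞,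
          (∀ i : ℤ, ξ (i + 1) - fderiv ℂ f (orbitZ f finv z0 i) (ξ i) = η i) ∧
          ‖ξ‖ ≤ M ∧
          ∀ ξ' : lp (fun _ : ℤ => Ck k) ∞,
            (∀ i : ℤ, ξ' (i + 1) - fderiv ℂ f (orbitZ f finv z0 i) (ξ' i) = η i) →
            ξ' = ξ := by
  obtain ⟨e, rfl, rfl⟩ : ∃ e : Equiv.Perm (Ck k), ⇑e = f ∧ ⇑e.symm = finv :=
    ⟨⟨f, finv, hli, hri⟩, rfl, rfl⟩
  have he := differentiable_zpow hf hfinv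
  simp only [orbitZ_eq_zpow, fderiv_eq_derivCocycle_one]
  constructor
  · intro h
    obtain ⟨P, C, q, K, hC, hq0, hq1, hG, hPK, hPP, hcomm⟩ := h.exists_green_bound hS
    obtain ⟨M, hM, hsol⟩ := exists_bounded_solution_of_green he hinvS hC hq0 hq1 hG
    refine ⟨M, hM, fun z hz η hη => ?_⟩
    obtain ⟨x, hx, hxM⟩ := hsol z hz η 1 fun i => hη ▸ lp.norm_apply_le_norm (by simp) η i
    rw [mul_one] at hxM
    refine ⟨⟨x, memℓp_infty_of_norm_le hxM⟩, hx, lp.norm_le_of_forall_le hM.le hxM,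
      fun ξ' hξ' => lp.ext (funext fun i => sub_eq_zero.1 ?_)⟩
    refine eq_zero_of_homogeneous_of_green he hinvS hC hq0 hq1 hG hPK hPP
      (fun w hw => hcomm w hw (by simpa using zpow_apply_mem hinvS hw 1)) hz
      (x := fun i => ξ' i - x i) (B := ‖ξ'‖ + M)
      (fun i => (norm_sub_le _ _).trans
        (add_le_add (lp.norm_apply_le_norm (by simp) ξ' i) (hxM i))) (fun i => ?_) i
    rw [map_sub, sub_eq_sub_iff_sub_eq_sub, hξ', hx]
  · rintro ⟨M, hM, h⟩
    have : Nonempty (Fin k) := ⟨⟨0, by omega⟩⟩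
    exact isHyperbolicSet_of_bounded_inverse he hinvS hS hM
      (fun z hz => norm_le_of_unique_solution (h z hz) hM)
      (fun z hz => exists_single_solution (h z hz) (-1))
end
end
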